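/- arXiv:2003.01703 — 8 statements merged into one kernel-verified Lean document; each statement's English description precedes it below -/
import Mathlib

section
/- Let T > 0 be a real number, let H be a nonempty finite set of functions from a set X to ℝ, let f0 : X → ℝ, and fix x ∈ X. Let m ∈ ℝ be a median of the multiset {f(x) : f ∈ H}, i.e. |{f ∈ H : f(x) ≥ m}| ≥ |H|/2 and |{f ∈ H : f(x) ≤ m}| ≥ |H|/2. If |m − f0(x)| > 2/T, then there exists y ∈ {m − 2/T, m + 2/T} such that, setting σ = sign(y − f0(x)), the retained set H' = {f ∈ H : σ·(y − f(x)) ≥ −1/T} satisfies |H'| ≤ |H|/2. -/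
theorem ncard_sep_le_half_of_disjoint {α : Type*} {H : Set α} (hH : H.Finite) {p q : α → Prop}
    (hpq : ∀ a, p a → ¬ q a) (hq : (H.ncard : ℝ) / 2 ≤ ({a ∈ H | q a}.ncard : ℝ)) :
    ({a ∈ H | p a}.ncard : ℝ) ≤ (H.ncard : ℝ) / 2 := by
  have hdisj : Disjoint {a ∈ H | p a} {a ∈ H | q a} :=
    Set.disjoint_left.2 fun a ha hb => hpq a ha.2 hb.2
  have hunion := Set.ncard_union_eq hdisj (hH.subset (Set.sep_subset H p))
    (hH.subset (Set.sep_subset H q))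
  have hle := Set.ncard_le_ncard (Set.union_subset (Set.sep_subset H p) (Set.sep_subset H q)) hH
  rw [hunion] at hle
  have hle' : ({a ∈ H | p a}.ncard : ℝ) + ({a ∈ H | q a}.ncard : ℝ) ≤ H.ncard := by
    exact_mod_cast hle
  linarith

theorem stmt5 {X : Type*} (T : ℝ) (hT : 0 < T)
    (H : Set (X → ℝ)) (hHfin : H.Finite) (hHne : H.Nonempty)
    (f0 : X → ℝ) (x : X) (m : ℝ)
    (hm1 : (H.ncard : ℝ) / 2 ≤ ({f ∈ H | m ≤ f x}.ncard : ℝ))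
    (hm2 : (H.ncard : ℝ) / 2 ≤ ({f ∈ H | f x ≤ m}.ncard : ℝ))
    (hfar : 2 / T < |m - f0 x|) :
    ∃ y ∈ ({m - 2/T, m + 2/T} : Set ℝ),
      (({f ∈ H | -(1/T) ≤ Real.sign (y - f0 x) * (y - f x)}.ncard : ℝ)
        ≤ (H.ncard : ℝ) / 2) := by
  have hpos : 0 < 1 / T := by positivity
  have htwo : 2 / T = 2 * (1 / T) := by ring
  rcases lt_abs.1 hfar with h | h
  · refine ⟨m - 2 / T, by simp, ncard_sep_le_half_of_disjoint hHfin (fun f hf hmf => ?_) hm1⟩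
    rw [Real.sign_of_pos (by linarith)] at hf
    linarith
  · refine ⟨m + 2 / T, by simp, ncard_sep_le_half_of_disjoint hHfin (fun f hf hmf => ?_) hm2⟩
    rw [Real.sign_of_neg (by linarith)] at hf
    linarith
end

section
/- Let ℋ be a class of functions from a set X to ℝ, with d_∞(f, g) = sup_{x∈X}|f(x) − g(x)|, and let f0 ∈ ℋ. Fix x ∈ X, reals r > 0 and z with 0 < z ≤ r, a nonempty set H0 ⊆ ℋ with sup_{f∈H0} f(x) − inf_{f∈H0} f(x) > 10r, and a set Hr of functions from X to ℝ such that every f ∈ H0 admits some f' ∈ Hr with d_∞(f, f') ≤ r. Suppose m ∈ ℝ satisfies |m − f0(x)| < 2z. Then there exist y ∈ {m − 2z, m + 2z} and f' ∈ Hr such that, setting σ = sign(y − f0(x)), one has σ·(y − f'(x)) < −r; that is, the binary feedback from querying y eliminates the hypothesis f' from Hr even allowing a margin of r. -/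
theorem stmt6 {X : Type*} (H : Set (X → ℝ)) (f0 : X → ℝ) (hf0 : f0 ∈ H)
    (x : X) (r z : ℝ) (hr : 0 < r) (hz : 0 < z) (hzr : z ≤ r)
    (H0 : Set (X → ℝ)) (hH0 : H0 ⊆ H) (hH0ne : H0.Nonempty)
    (Hr : Set (X → ℝ))
    (hnet : ∀ f ∈ H0, ∃ f' ∈ Hr, ∀ x' : X, |f x' - f' x'| ≤ r)
    (hwidth : ∃ f ∈ H0, ∃ g ∈ H0, 10 * r < f x - g x)
    (m : ℝ) (hm : |m - f0 x| < 2 * z) :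
    ∃ y ∈ ({m - 2*z, m + 2*z} : Set ℝ), ∃ f' ∈ Hr,
      Real.sign (y - f0 x) * (y - f' x) < -r := by
  obtain ⟨f, hf, g, hg, hfg⟩ := hwidth
  obtain ⟨f', hf', hff'⟩ := hnet f hf
  obtain ⟨g', hg', hgg'⟩ := hnet g hg
  have hfx := abs_le.mp (hff' x)
  have hgx := abs_le.mp (hgg' x)
  obtain ⟨hm₁, hm₂⟩ := abs_lt.mp hm
  by_cases h : m + 2 * z + r < f' x
  · refine ⟨m + 2 * z, by simp, f', hf', ?_⟩
    rw [Real.sign_of_pos (by linarith)]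
    linarith
  · refine ⟨m - 2 * z, by simp, g', hg', ?_⟩
    rw [Real.sign_of_neg (by linarith)]
    linarith
end

section
/- Let X be a set and ℋ a nonempty class of functions X → [0,1], with loss ℓ(y, y') = |y − y'| and d_∞(f, g) = sup_{x∈X}|f(x) − g(x)|, and suppose the covering dimension d = Cdim(ℋ) is finite. Then there exist a universal constant C and a randomized learning strategy with the following guarantee: for every hidden f0 ∈ ℋ, every horizon T, and every adaptively chosen sequence x_1, …, x_T ∈ X, where in each round the learner outputs y_t and then observes only σ_t = sign(y_t − f0(x_t)) (arbitrary in {−1,+1} if y_t = f0(x_t)), the expected total loss satisfies E[Σ_{t=1}^T |y_t − f0(x_t)|] ≤ C·d². -/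
open scoped Classical

/-- `IsENet H S ε`: `S ⊆ H` is an `ε`-net of `H` for the metric
`d_∞(f, g) = sup_x |f x − g x|`. -/
def IsENet {X : Type*} (H S : Set (X → ℝ)) (ε : ℝ) : Prop :=
  S ⊆ H ∧ ∀ f ∈ H, ∃ g ∈ S, ∀ x : X, |f x - g x| ≤ ε

/-- The minimum cardinality of an `ε`-net of `H` (`⊤` if no finite `ε`-net exists). -/
noncomputable def coveringNumber {X : Type*} (H : Set (X → ℝ)) (ε : ℝ) : ℕ∞ :=
  sInf {n : ℕ∞ | ∃ S : Set (X → ℝ), S.Finite ∧ IsENet H S ε ∧ (S.ncard : ℕ∞) = n}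

/-- The covering dimension `Cdim(H) = sup_{0 < ε ≤ 1/2} log N_ε(H) / log (1/ε)`. -/
noncomputable def coveringDim {X : Type*} (H : Set (X → ℝ)) : ℝ :=
  sSup {c : ℝ | ∃ ε : ℝ, 0 < ε ∧ ε ≤ 1/2 ∧
    c = Real.log ((coveringNumber H ε).toNat : ℝ) / Real.log (1/ε)}

/-- A history: the list of past rounds, each recorded as (context, guess, binary feedback),
where feedback `true` means the guess was strictly above the hidden value. -/
abbrev Hist (X : Type*) := List (X × ℝ × Bool)

/-- The binary feedback `σ_t = sign (y_t − f0 x_t)` on a guess `y` in context `x`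
(`true` meaning `y > f0 x`), with ties broken arbitrarily by the adversary's tie rule. -/
noncomputable def feedback {X : Type*} (f0 : X → ℝ) (tie : Hist X → X → ℝ → Bool)
    (h : Hist X) (x : X) (y : ℝ) : Bool :=
  if f0 x < y then true else if y < f0 x then false else tie h x y

/-- Expected total symmetric loss of a randomized strategy `strat` over `T` rounds against
an adaptive adversary `adv` choosing contexts (with tie-breaking rule `tie`), starting from
history `h`, when the hidden function is `f0`; the only information entering the history
each round is the binary feedback. -/
noncomputable def expLoss {X : Type*} (strat : Hist X → X → PMF ℝ) (adv : Hist X → X)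
    (tie : Hist X → X → ℝ → Bool) (f0 : X → ℝ) : ℕ → Hist X → ℝ
  | 0, _ => 0
  | T + 1, h =>
    ∑' y : ℝ, ((strat h (adv h)) y).toReal *
      (|y - f0 (adv h)| +
        expLoss strat adv tie f0 T (h ++ [(adv h, y, feedback f0 tie h (adv h) y)]))

/-- An odd, continuous, bounded comparison function which vanishes on `[-ε, ε]`. -/
noncomputable def bump (ε u : ℝ) : ℝ :=
  max 0 (min (u / ε - 1) (1 / 2)) - max 0 (min (-u / ε - 1) (1 / 2))

lemma bump_neg (ε u : ℝ) : bump ε (-u) = -bump ε u := by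
  simp [bump]

lemma continuous_bump (ε : ℝ) : Continuous (bump ε) := by
  unfold bump
  fun_prop

lemma abs_bump_le (ε u : ℝ) : |bump ε u| ≤ 1 / 2 := by
  have h (a : ℝ) : 0 ≤ max 0 (min a (1 / 2)) ∧ max 0 (min a (1 / 2)) ≤ 1 / 2 :=
    ⟨le_max_left _ _, max_le (by norm_num) (min_le_right _ _)⟩
  have h1 := h (u / ε - 1)
  have h2 := h (-u / ε - 1)
  unfold bump
  rw [abs_le]
  constructor <;> linarith

lemma bump_nonneg {ε u : ℝ} (hε : 0 < ε) (hu : -ε ≤ u) : 0 ≤ bump ε u := by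
  have h : -u / ε - 1 ≤ 0 := by
    rw [sub_nonpos, div_le_one hε]
    linarith
  rw [bump, max_eq_left ((min_le_left _ _).trans h), sub_zero]
  exact le_max_left _ _

lemma bump_eq_half {ε u : ℝ} (hε : 0 < ε) (hu : 3 / 2 * ε ≤ u) : bump ε u = 1 / 2 := by
  have h1 : 1 / 2 ≤ u / ε - 1 := by
    rw [le_sub_iff_add_le, le_div_iff₀ hε]
    linarith
  have h2 : -u / ε - 1 ≤ 0 := by
    rw [sub_nonpos, div_le_one hε]
    linarith
  rw [bump, max_eq_left ((min_le_left _ _).trans h2), min_eq_right h1]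
  norm_num

/-- The sign of `f0 x - y` announced by the feedback. -/
def feedbackSign (b : Bool) : ℝ := if b then -1 else 1

lemma feedbackSign_eq (b : Bool) : feedbackSign b = 1 ∨ feedbackSign b = -1 := by
  cases b <;> simp [feedbackSign]

lemma feedbackSign_feedback_mul {X : Type*} (f0 : X → ℝ) (tie : Hist X → X → ℝ → Bool)
    (h : Hist X) (x : X) (y : ℝ) :
    feedbackSign (feedback f0 tie h x y) * (f0 x - y) = |y - f0 x| := by
  unfold feedback
  split_ifs with h1 h2
  · rw [abs_of_pos (by linarith)]
    simp [feedbackSign]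
  · rw [abs_of_neg (by linarith)]
    simp [feedbackSign]
  · have : f0 x = y := le_antisymm (not_lt.1 h2) (not_lt.1 h1)
    simp [this]

/-- The update factor of the hypothesis `g` after one round. -/
noncomputable def updateFactor {X : Type*} (ε : ℝ) (g : X → ℝ) (r : X × ℝ × Bool) : ℝ :=
  1 + feedbackSign r.2.2 * bump ε (g r.1 - r.2.1)

lemma updateFactor_mem {X : Type*} (ε : ℝ) (g : X → ℝ) (r : X × ℝ × Bool) :
    1 / 2 ≤ updateFactor ε g r ∧ updateFactor ε g r ≤ 3 / 2 := by
  have h := abs_le.1 (abs_bump_le ε (g r.1 - r.2.1))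
  unfold updateFactor
  rcases feedbackSign_eq r.2.2 with hs | hs <;> rw [hs] <;> constructor <;> linarith

/-- The multiplicative weight of `g` at resolution `ε` after the history `h`. -/
noncomputable def weight {X : Type*} (ε : ℝ) (h : Hist X) (g : X → ℝ) : ℝ :=
  (h.map (updateFactor ε g)).prod

lemma weight_append {X : Type*} (ε : ℝ) (h : Hist X) (r : X × ℝ × Bool) (g : X → ℝ) :
    weight ε (h ++ [r]) g = weight ε h g * updateFactor ε g r := by
  simp [weight]

lemma weight_mem {X : Type*} (ε : ℝ) (h : Hist X) (g : X → ℝ) :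
    (1 / 2) ^ h.length ≤ weight ε h g ∧ weight ε h g ≤ (3 / 2) ^ h.length := by
  induction h with
  | nil => simp [weight]
  | cons r h ih =>
    have hr := updateFactor_mem ε g r
    have hw : 0 ≤ weight ε h g := le_trans (by positivity) ih.1
    have e : weight ε (r :: h) g = weight ε h g * updateFactor ε g r := by
      simp [weight, mul_comm]
    rw [e, List.length_cons, pow_succ, pow_succ]
    exact ⟨mul_le_mul ih.1 hr.1 (by norm_num) hw,
      mul_le_mul ih.2 hr.2 (by linarith) (by positivity)⟩

lemma weight_pos {X : Type*} (ε : ℝ) (h : Hist X) (g : X → ℝ) : 0 < weight ε h g :=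
  lt_of_lt_of_le (by positivity) (weight_mem ε h g).1

/-- The total weight of the net `S`. -/
noncomputable def totalWeight {X : Type*} (S : Finset (X → ℝ)) (ε : ℝ) (h : Hist X) : ℝ :=
  ∑ g ∈ S, weight ε h g

/-- The weighted average of the comparisons of `g x` with `y` over the net `S`. -/
noncomputable def bias {X : Type*} (S : Finset (X → ℝ)) (ε : ℝ) (h : Hist X) (x : X)
    (y : ℝ) : ℝ :=
  (∑ g ∈ S, weight ε h g * bump ε (g x - y)) / totalWeight S ε h

lemma weight_le_totalWeight {X : Type*} {S : Finset (X → ℝ)} {g : X → ℝ} (hg : g ∈ S)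
    (ε : ℝ) (h : Hist X) : weight ε h g ≤ totalWeight S ε h :=
  Finset.single_le_sum (fun g _ => (weight_pos ε h g).le) hg

lemma totalWeight_nonneg {X : Type*} (S : Finset (X → ℝ)) (ε : ℝ) (h : Hist X) :
    0 ≤ totalWeight S ε h :=
  Finset.sum_nonneg fun g _ => (weight_pos ε h g).le

lemma abs_bias_le {X : Type*} (S : Finset (X → ℝ)) (ε : ℝ) (h : Hist X) (x : X) (y : ℝ) :
    |bias S ε h x y| ≤ 1 / 2 := by
  have h0 := totalWeight_nonneg S ε h
  rw [bias, abs_div, abs_of_nonneg h0]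
  refine div_le_of_le_mul₀ h0 (by norm_num) ?_
  calc |∑ g ∈ S, weight ε h g * bump ε (g x - y)|
      ≤ ∑ g ∈ S, |weight ε h g * bump ε (g x - y)| := Finset.abs_sum_le_sum_abs _ _
    _ ≤ ∑ g ∈ S, 1 / 2 * weight ε h g := by
      refine Finset.sum_le_sum fun g _ => ?_
      rw [abs_mul, abs_of_pos (weight_pos ε h g), mul_comm]
      exact mul_le_mul_of_nonneg_right (abs_bump_le _ _) (weight_pos ε h g).le
    _ = 1 / 2 * totalWeight S ε h := by rw [totalWeight, Finset.mul_sum]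

lemma continuous_bias {X : Type*} (S : Finset (X → ℝ)) (ε : ℝ) (h : Hist X) (x : X) :
    Continuous (bias S ε h x) := by
  have := continuous_bump ε
  unfold bias
  fun_prop

lemma totalWeight_append {X : Type*} {S : Finset (X → ℝ)} {ε : ℝ} {h : Hist X}
    (hW : totalWeight S ε h ≠ 0) (x : X) (y : ℝ) (b : Bool) :
    totalWeight S ε (h ++ [(x, y, b)]) =
      totalWeight S ε h * (1 + feedbackSign b * bias S ε h x y) := by
  have e : totalWeight S ε h * bias S ε h x y = ∑ g ∈ S, weight ε h g * bump ε (g x - y) := by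
    rw [bias, mul_div_cancel₀ _ hW]
  have e' : totalWeight S ε h * (1 + feedbackSign b * bias S ε h x y) =
      totalWeight S ε h + feedbackSign b * (totalWeight S ε h * bias S ε h x y) := by ring
  rw [e', e, totalWeight, totalWeight, Finset.mul_sum, ← Finset.sum_add_distrib]
  refine Finset.sum_congr rfl fun g _ => ?_
  rw [weight_append, updateFactor]
  ring

/-- The dyadic scales. -/
noncomputable def dyadicScale (k : ℕ) : ℝ := (1 / 2) ^ (k + 1)

lemma dyadicScale_pos (k : ℕ) : 0 < dyadicScale k := by
  unfold dyadicScale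
  positivity

lemma dyadicScale_le (k : ℕ) : dyadicScale k ≤ 1 / 2 := by
  unfold dyadicScale
  rw [pow_succ]
  have : (1 / 2 : ℝ) ^ k ≤ 1 := pow_le_one₀ (by norm_num) (by norm_num)
  linarith

lemma summable_pow_mul_dyadicScale (n : ℕ) :
    Summable fun k : ℕ => ((k : ℝ) + 1) ^ n * dyadicScale k := by
  have h := summable_pow_mul_geometric_of_norm_lt_one n (r := (1 / 2 : ℝ)) (by norm_num)
  simpa [dyadicScale] using (summable_nat_add_iff 1).2 h

lemma summable_dyadicScale : Summable dyadicScale := by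
  simpa using summable_pow_mul_dyadicScale 0

lemma log_inv_dyadicScale (k : ℕ) : Real.log (1 / dyadicScale k) = (k + 1) * Real.log 2 := by
  simp [dyadicScale, Real.log_pow]

/-- The multiscale average of the biases. -/
noncomputable def multiscaleBias {X : Type*} (N : ℕ → Finset (X → ℝ)) (h : Hist X) (x : X)
    (y : ℝ) : ℝ :=
  ∑' k, dyadicScale k * bias (N k) (dyadicScale k) h x y

lemma norm_dyadicScale_mul_bias_le {X : Type*} (N : ℕ → Finset (X → ℝ)) (h : Hist X) (x : X)
    (k : ℕ) (y : ℝ) : ‖dyadicScale k * bias (N k) (dyadicScale k) h x y‖ ≤ dyadicScale k := by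
  rw [Real.norm_eq_abs, abs_mul, abs_of_pos (dyadicScale_pos k)]
  have := abs_bias_le (N k) (dyadicScale k) h x y
  nlinarith [dyadicScale_pos k]

lemma summable_dyadicScale_mul_bias {X : Type*} (N : ℕ → Finset (X → ℝ)) (h : Hist X) (x : X)
    (y : ℝ) : Summable fun k => dyadicScale k * bias (N k) (dyadicScale k) h x y :=
  .of_norm_bounded summable_dyadicScale fun k => norm_dyadicScale_mul_bias_le N h x k y

lemma continuous_multiscaleBias {X : Type*} (N : ℕ → Finset (X → ℝ)) (h : Hist X) (x : X) :
    Continuous (multiscaleBias N h x) :=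
  continuous_tsum (fun k => continuous_const.mul (continuous_bias (N k) _ h x))
    summable_dyadicScale (norm_dyadicScale_mul_bias_le N h x)

lemma exists_multiscaleBias_eq_zero {X : Type*} {N : ℕ → Finset (X → ℝ)}
    (hN : ∀ k, ∀ g ∈ N k, ∀ x, g x ∈ Set.Icc (0 : ℝ) 1) (h : Hist X) (x : X) :
    ∃ y ∈ Set.Icc (0 : ℝ) 1, multiscaleBias N h x y = 0 := by
  have h0 : 0 ≤ multiscaleBias N h x 0 := by
    refine tsum_nonneg fun k => mul_nonneg (dyadicScale_pos k).le
      (div_nonneg (Finset.sum_nonneg fun g hg => ?_) (totalWeight_nonneg _ _ _))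
    refine mul_nonneg (weight_pos _ _ _).le (bump_nonneg (dyadicScale_pos k) ?_)
    have := (hN k g hg x).1
    linarith [dyadicScale_pos k]
  have h1 : multiscaleBias N h x 1 ≤ 0 := by
    refine tsum_nonpos fun k => mul_nonpos_of_nonneg_of_nonpos (dyadicScale_pos k).le
      (div_nonpos_of_nonpos_of_nonneg (Finset.sum_nonpos fun g hg => ?_)
        (totalWeight_nonneg _ _ _))
    refine mul_nonpos_of_nonneg_of_nonpos (weight_pos _ _ _).le ?_
    rw [← neg_sub, bump_neg, neg_nonpos]
    refine bump_nonneg (dyadicScale_pos k) ?_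
    have := (hN k g hg x).2
    linarith [dyadicScale_pos k]
  exact intermediate_value_Icc' zero_le_one (continuous_multiscaleBias N h x).continuousOn
    ⟨h1, h0⟩

/-- The relative entropy of the hypothesis `g` in the net `S`. -/
noncomputable def logRatio {X : Type*} (S : Finset (X → ℝ)) (ε : ℝ) (g : X → ℝ)
    (h : Hist X) : ℝ :=
  Real.log (totalWeight S ε h) - Real.log (weight ε h g)

lemma logRatio_nonneg {X : Type*} {S : Finset (X → ℝ)} {g : X → ℝ} (hg : g ∈ S) (ε : ℝ)
    (h : Hist X) : 0 ≤ logRatio S ε g h :=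
  sub_nonneg.2 (Real.log_le_log (weight_pos ε h g) (weight_le_totalWeight hg ε h))

lemma logRatio_nil {X : Type*} (S : Finset (X → ℝ)) (ε : ℝ) (g : X → ℝ) :
    logRatio S ε g [] = Real.log S.card := by
  simp [logRatio, totalWeight, weight]

lemma logRatio_le {X : Type*} {S : Finset (X → ℝ)} {g : X → ℝ} (hg : g ∈ S) (ε : ℝ)
    (h : Hist X) : logRatio S ε g h ≤ Real.log S.card + h.length * Real.log 3 := by
  have hS : (0 : ℝ) < S.card := by exact_mod_cast Finset.card_pos.2 ⟨g, hg⟩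
  have h1 : Real.log (totalWeight S ε h) ≤ Real.log S.card + h.length * Real.log (3 / 2) := by
    rw [← Real.log_pow, ← Real.log_mul hS.ne' (by positivity)]
    refine Real.log_le_log ((weight_pos ε h g).trans_le (weight_le_totalWeight hg ε h)) ?_
    have := Finset.sum_le_card_nsmul S (weight ε h) _ fun g _ => (weight_mem ε h g).2
    simpa [totalWeight] using this
  have h2 : h.length * Real.log (1 / 2) ≤ Real.log (weight ε h g) := by
    rw [← Real.log_pow]
    exact Real.log_le_log (by positivity) (weight_mem ε h g).1
  have h3 : Real.log 3 = Real.log (3 / 2) - Real.log (1 / 2) := by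
    rw [← Real.log_div (by norm_num) (by norm_num)]
    norm_num
  rw [logRatio, h3]
  linarith

lemma logRatio_append_le {X : Type*} {S : Finset (X → ℝ)} {g : X → ℝ} (hg : g ∈ S) (ε : ℝ)
    (h : Hist X) (x : X) (y : ℝ) (b : Bool) :
    logRatio S ε g (h ++ [(x, y, b)]) + Real.log (updateFactor ε g (x, y, b)) ≤
      logRatio S ε g h + feedbackSign b * bias S ε h x y := by
  have hW : 0 < totalWeight S ε h := (weight_pos ε h g).trans_le (weight_le_totalWeight hg ε h)
  have hu : 0 < updateFactor ε g (x, y, b) :=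
    lt_of_lt_of_le (by norm_num) (updateFactor_mem ε g (x, y, b)).1
  have hb : 0 < 1 + feedbackSign b * bias S ε h x y := by
    have := abs_le.1 (abs_bias_le S ε h x y)
    rcases feedbackSign_eq b with hs | hs <;> rw [hs] <;> linarith
  rw [logRatio, logRatio, totalWeight_append hW.ne', weight_append,
    Real.log_mul hW.ne' hb.ne', Real.log_mul (weight_pos ε h g).ne' hu.ne']
  linarith [Real.log_le_sub_one_of_pos hb]

/-- The multiscale potential of the hypotheses `g k`. -/
noncomputable def potential {X : Type*} (N : ℕ → Finset (X → ℝ)) (g : ℕ → X → ℝ)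
    (h : Hist X) : ℝ :=
  ∑' k, dyadicScale k * logRatio (N k) (dyadicScale k) (g k) h

section Potential

variable {X : Type*} {N : ℕ → Finset (X → ℝ)} {g : ℕ → X → ℝ}

lemma potential_nonneg (hg : ∀ k, g k ∈ N k) (h : Hist X) : 0 ≤ potential N g h :=
  tsum_nonneg fun k => mul_nonneg (dyadicScale_pos k).le (logRatio_nonneg (hg k) _ h)

lemma summable_potential (hg : ∀ k, g k ∈ N k)
    (hN : Summable fun k => dyadicScale k * Real.log (N k).card) (h : Hist X) :
    Summable fun k => dyadicScale k * logRatio (N k) (dyadicScale k) (g k) h := by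
  refine .of_nonneg_of_le
    (fun k => mul_nonneg (dyadicScale_pos k).le (logRatio_nonneg (hg k) _ h))
    (fun k => mul_le_mul_of_nonneg_left (logRatio_le (hg k) _ h) (dyadicScale_pos k).le) ?_
  simp_rw [mul_add]
  exact hN.add (summable_dyadicScale.mul_right _)

lemma updateFactor_eq_one_add_bump (ε : ℝ) (g : X → ℝ) (x : X) (y : ℝ) (b : Bool) :
    updateFactor ε g (x, y, b) = 1 + bump ε (feedbackSign b * (g x - y)) := by
  rcases feedbackSign_eq b with hs | hs
  · simp [updateFactor, hs]
  · rw [updateFactor, hs, neg_one_mul, neg_one_mul, bump_neg]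

/-- A correct comparison at every scale pays for the loss of the round. -/
lemma loss_le_tsum_log_updateFactor {f0 : X → ℝ} {x : X}
    (hf : ∀ k, |f0 x - g k x| ≤ dyadicScale k) {y : ℝ} (hy : |y - f0 x| ≤ 1)
    (tie : Hist X → X → ℝ → Bool) (h : Hist X) :
    (Summable fun k => dyadicScale k *
      Real.log (updateFactor (dyadicScale k) (g k) (x, y, feedback f0 tie h x y))) ∧
    |y - f0 x| ≤ 15 * ∑' k, dyadicScale k *
      Real.log (updateFactor (dyadicScale k) (g k) (x, y, feedback f0 tie h x y)) := by
  have hv := feedbackSign_feedback_mul f0 tie h x y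
  set b := feedback f0 tie h x y
  have hs (k : ℕ) : |y - f0 x| - dyadicScale k ≤ feedbackSign b * (g k x - y) := by
    have := abs_le.1 (hf k)
    rcases feedbackSign_eq b with hb | hb <;> rw [hb] at hv ⊢ <;> linarith
  have h1 (k : ℕ) : 0 ≤ Real.log (updateFactor (dyadicScale k) (g k) (x, y, b)) := by
    refine Real.log_nonneg ?_
    rw [updateFactor_eq_one_add_bump]
    have := bump_nonneg (dyadicScale_pos k) (u := feedbackSign b * (g k x - y))
      (by linarith [hs k, abs_nonneg (y - f0 x)])
    linarith
  have h2 (k : ℕ) : Real.log (updateFactor (dyadicScale k) (g k) (x, y, b)) ≤ 1 := by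
    have hu := updateFactor_mem (dyadicScale k) (g k) (x, y, b)
    linarith [Real.log_le_sub_one_of_pos (lt_of_lt_of_le (by norm_num) hu.1)]
  have hnn (k : ℕ) := mul_nonneg (dyadicScale_pos k).le (h1 k)
  have hsum : Summable fun k => dyadicScale k *
      Real.log (updateFactor (dyadicScale k) (g k) (x, y, b)) :=
    .of_nonneg_of_le hnn (fun k => mul_le_of_le_one_right (dyadicScale_pos k).le (h2 k))
      summable_dyadicScale
  refine ⟨hsum, ?_⟩
  rcases (abs_nonneg (y - f0 x)).eq_or_lt with h0 | h0
  · rw [← h0]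
    exact mul_nonneg (by norm_num) (tsum_nonneg hnn)
  obtain ⟨n, hn1, hn2⟩ := exists_nat_pow_near_of_lt_one (x := 2 / 5 * |y - f0 x|)
    (y := (1 / 2 : ℝ)) (by linarith) (by linarith) (by norm_num) (by norm_num)
  have hn3 : |y - f0 x| / 5 ≤ dyadicScale n := by
    rw [dyadicScale, pow_succ]
    linarith
  change dyadicScale n < _ at hn1
  have hlog : 1 / 3 ≤ Real.log (updateFactor (dyadicScale n) (g n) (x, y, b)) := by
    rw [updateFactor_eq_one_add_bump,
      bump_eq_half (dyadicScale_pos n) (by linarith [hs n])]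
    have := Real.one_sub_inv_le_log_of_pos (x := 1 + 1 / 2) (by norm_num)
    norm_num at this ⊢
    linarith
  have hle := hsum.le_tsum n fun k _ => hnn k
  nlinarith [dyadicScale_pos n]

lemma loss_add_potential_le (hg : ∀ k, g k ∈ N k)
    (hN : Summable fun k => dyadicScale k * Real.log (N k).card) {f0 : X → ℝ} {x : X}
    (hf : ∀ k, |f0 x - g k x| ≤ dyadicScale k) {y : ℝ} (hy : |y - f0 x| ≤ 1)
    (tie : Hist X → X → ℝ → Bool) (h : Hist X) (h0 : multiscaleBias N h x y = 0) :
    |y - f0 x| + 15 * potential N g (h ++ [(x, y, feedback f0 tie h x y)]) ≤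
      15 * potential N g h := by
  obtain ⟨hsum, hloss⟩ := loss_le_tsum_log_updateFactor hf hy tie h
  set b := feedback f0 tie h x y
  have hp := summable_potential hg hN h
  have hp' := summable_potential hg hN (h ++ [(x, y, b)])
  have hb := (summable_dyadicScale_mul_bias N h x y).mul_left (feedbackSign b)
  have key := (hp'.add hsum).tsum_le_tsum (fun k => ?_) (hp.add hb)
  · rw [hp'.tsum_add hsum, hp.tsum_add hb, tsum_mul_left] at key
    change potential N g _ + _ ≤ potential N g h + _ * multiscaleBias N h x y at key
    rw [h0, mul_zero, add_zero] at key
    linarith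
  · have := mul_le_mul_of_nonneg_left (logRatio_append_le (hg k) (dyadicScale k) h x y b)
      (dyadicScale_pos k).le
    linarith

end Potential

lemma expLoss_pure_succ {X : Type*} (guess : Hist X → X → ℝ) (adv : Hist X → X)
    (tie : Hist X → X → ℝ → Bool) (f0 : X → ℝ) (T : ℕ) (h : Hist X) :
    expLoss (fun h x => PMF.pure (guess h x)) adv tie f0 (T + 1) h =
      |guess h (adv h) - f0 (adv h)| +
        expLoss (fun h x => PMF.pure (guess h x)) adv tie f0 T
          (h ++ [(adv h, guess h (adv h), feedback f0 tie h (adv h) (guess h (adv h)))]) := by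
  rw [expLoss, tsum_eq_single (guess h (adv h))]
  · simp
  · intro y hy
    simp [PMF.pure_apply, hy]

/-- A class with finite nets at the dyadic scales admits a deterministic strategy whose loss
is controlled by the metric entropies of the nets. -/
lemma exists_strategy_of_nets {X : Type*} {H : Set (X → ℝ)} {N : ℕ → Finset (X → ℝ)}
    (hH : ∀ f ∈ H, ∀ x, f x ∈ Set.Icc (0 : ℝ) 1)
    (hnet : ∀ k, IsENet H (N k) (dyadicScale k))
    (hN : Summable fun k => dyadicScale k * Real.log (N k).card) :
    ∃ strat : Hist X → X → PMF ℝ,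
      ∀ f0 ∈ H, ∀ (T : ℕ) (adv : Hist X → X) (tie : Hist X → X → ℝ → Bool),
        expLoss strat adv tie f0 T [] ≤ 15 * ∑' k, dyadicScale k * Real.log (N k).card := by
  choose guess hguess hzero using
    exists_multiscaleBias_eq_zero fun k g hg x => hH g ((hnet k).1 hg) x
  refine ⟨fun h x => PMF.pure (guess h x), fun f0 hf0 T adv tie => ?_⟩
  choose g hg hfg using fun k => (hnet k).2 f0 hf0
  have main (T : ℕ) (h : Hist X) :
      expLoss (fun h x => PMF.pure (guess h x)) adv tie f0 T h ≤ 15 * potential N g h := by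
    induction T generalizing h with
    | zero => exact mul_nonneg (by norm_num) (potential_nonneg hg h)
    | succ T ih =>
      rw [expLoss_pure_succ]
      have hy := hguess h (adv h)
      have hv := hH f0 hf0 (adv h)
      have hd : |guess h (adv h) - f0 (adv h)| ≤ 1 :=
        abs_le.2 ⟨by linarith [hy.1, hv.2], by linarith [hy.2, hv.1]⟩
      exact (add_le_add_right (ih _) _).trans
        (loss_add_potential_le hg hN (fun k => hfg k (adv h)) hd tie h (hzero h (adv h)))
  simpa [potential, logRatio_nil] using main T []

lemma exists_finset_isENet_of_coveringNumber_ne_top {X : Type*} {H : Set (X → ℝ)} {ε : ℝ}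
    (h : coveringNumber H ε ≠ ⊤) :
    ∃ S : Finset (X → ℝ), IsENet H S ε ∧ S.card = (coveringNumber H ε).toNat := by
  have hne : {n : ℕ∞ | ∃ S : Set (X → ℝ), S.Finite ∧ IsENet H S ε ∧
      (S.ncard : ℕ∞) = n}.Nonempty := by
    by_contra hcon
    exact h (by rw [coveringNumber, Set.not_nonempty_iff_eq_empty.1 hcon, sInf_empty])
  obtain ⟨S, hS, hnet, hcard⟩ := csInf_mem hne
  refine ⟨hS.toFinset, by simpa using hnet, ?_⟩
  rw [coveringNumber, ← hcard, ENat.toNat_natCast, Set.ncard_eq_toFinset_card S hS]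

lemma log_natCast_le_sq_div (n : ℕ) : Real.log n ≤ Real.log n ^ 2 / Real.log 2 := by
  have h2 : 0 < Real.log 2 := Real.log_pos (by norm_num)
  rw [le_div_iff₀ h2]
  rcases Nat.lt_or_ge n 2 with hn | hn
  · interval_cases n <;> simp
  · have : Real.log 2 ≤ Real.log n := Real.log_le_log (by norm_num) (by exact_mod_cast hn)
    nlinarith

/-- Online learning with binary feedback: there is a randomized strategy whose expected
total symmetric loss is at most `C·d²` where `d` is the covering dimension of the class. -/
theorem stmt7 : ∃ C : ℝ, ∀ (X : Type) (H : Set (X → ℝ)),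
    H.Nonempty → (∀ f ∈ H, ∀ x : X, f x ∈ Set.Icc (0:ℝ) 1) →
    ∀ d : ℝ,
    (∀ ε : ℝ, 0 < ε → ε ≤ 1/2 → coveringNumber H ε ≠ ⊤) →
    BddAbove {c : ℝ | ∃ ε : ℝ, 0 < ε ∧ ε ≤ 1/2 ∧
      c = Real.log ((coveringNumber H ε).toNat : ℝ) / Real.log (1/ε)} →
    coveringDim H = d →
    ∃ strat : Hist X → X → PMF ℝ,
      ∀ f0 ∈ H, ∀ (T : ℕ) (adv : Hist X → X) (tie : Hist X → X → ℝ → Bool),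
        expLoss strat adv tie f0 T [] ≤ C * d ^ 2 := by
  refine ⟨15 * (Real.log 2 * ∑' k : ℕ, ((k : ℝ) + 1) ^ 2 * dyadicScale k), ?_⟩
  intro X H _ hH d hfin hbdd hd
  choose N hnet hcard using fun k => exists_finset_isENet_of_coveringNumber_ne_top
    (hfin (dyadicScale k) (dyadicScale_pos k) (dyadicScale_le k))
  have hlog2 : 0 < Real.log 2 := Real.log_pos (by norm_num)
  have hlog (k : ℕ) : Real.log (N k).card ≤ d * ((k + 1) * Real.log 2) := by
    rw [hcard, ← log_inv_dyadicScale, ← div_le_iff₀, ← hd]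
    · exact le_csSup hbdd ⟨_, dyadicScale_pos k, dyadicScale_le k, rfl⟩
    · rw [log_inv_dyadicScale]
      positivity
  have hterm (k : ℕ) : dyadicScale k * Real.log (N k).card ≤
      Real.log 2 * d ^ 2 * (((k : ℝ) + 1) ^ 2 * dyadicScale k) := by
    have hsq : Real.log (N k).card ^ 2 / Real.log 2 ≤
        (d * ((k + 1) * Real.log 2)) ^ 2 / Real.log 2 :=
      div_le_div_of_nonneg_right
        (pow_le_pow_left₀ (Real.log_natCast_nonneg _) (hlog k) 2) hlog2.le
    calc dyadicScale k * Real.log (N k).card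
        ≤ dyadicScale k * ((d * ((k + 1) * Real.log 2)) ^ 2 / Real.log 2) :=
          mul_le_mul_of_nonneg_left ((log_natCast_le_sq_div _).trans hsq) (dyadicScale_pos k).le
      _ = _ := by
        field_simp
  have hmaj := (summable_pow_mul_dyadicScale 2).mul_left (Real.log 2 * d ^ 2)
  have hN : Summable fun k => dyadicScale k * Real.log (N k).card :=
    .of_nonneg_of_le (fun k => mul_nonneg (dyadicScale_pos k).le (Real.log_natCast_nonneg _))
      hterm hmaj
  obtain ⟨strat, hstrat⟩ := exists_strategy_of_nets hH hnet hN
  refine ⟨strat, fun f0 hf0 T adv tie => (hstrat f0 hf0 T adv tie).trans ?_⟩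
  have key := hN.tsum_le_tsum hterm hmaj
  rw [tsum_mul_left] at key
  linarith
end

section
/- Let N be a finite set, let w : N → (0, 1] satisfy Σ_{f∈N} w(f) = 1, and fix f1 ∈ N. Let N = P ⊔ M be a partition with f1 ∈ P, and put W⁻ = Σ_{f∈M} w(f) and W⁺ = 1 − W⁻. Fix reals 0 < p < p' < 1/2, and define the two renormalized updates: w⁺(f) = (1−p')·w(f)/Z⁺ for f ∈ P and w⁺(f) = p'·w(f)/Z⁺ for f ∈ M, where Z⁺ = (1−p')·W⁺ + p'·W⁻; and w⁻(f) = p'·w(f)/Z⁻ for f ∈ P and w⁻(f) = (1−p')·w(f)/Z⁻ for f ∈ M, where Z⁻ = p'·W⁺ + (1−p')·W⁻. Then (1−p)·(1/w⁺(f1)) + p·(1/w⁻(f1)) = (1 − c·W⁻)/w(f1), where c = (p' − p)·[(1−p')/p' − p'/(1−p')], and moreover 0 < c < 1. -/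
theorem stmt10 {ι : Type*} [Fintype ι]
    (w : ι → ℝ) (hw : ∀ f, 0 < w f ∧ w f ≤ 1) (hsum : ∑ f, w f = 1)
    (f1 : ι) (P : ι → Prop) [DecidablePred P] (hf1 : P f1)
    (p p' : ℝ) (hp : 0 < p) (hpp' : p < p') (hp' : p' < 1/2)
    (Wm : ℝ) (hWm : Wm = ∑ f ∈ Finset.univ.filter (fun f => ¬ P f), w f)
    (Zp Zm : ℝ)
    (hZp : Zp = (1 - p') * (1 - Wm) + p' * Wm)
    (hZm : Zm = p' * (1 - Wm) + (1 - p') * Wm)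
    (wp wm : ι → ℝ)
    (hwp : ∀ f, wp f = if P f then (1 - p') * w f / Zp else p' * w f / Zp)
    (hwm : ∀ f, wm f = if P f then p' * w f / Zm else (1 - p') * w f / Zm)
    (c : ℝ) (hc : c = (p' - p) * ((1 - p') / p' - p' / (1 - p'))) :
    (1 - p) * (1 / wp f1) + p * (1 / wm f1) = (1 - c * Wm) / w f1 ∧ 0 < c ∧ c < 1 := by
  have hw1 : w f1 ≠ 0 := (hw f1).1.ne'
  have hq : 0 < p' := hp.trans hpp'
  have hq1 : 0 < 1 - p' := by linarith
  have hc' : c = (p' - p) * (1 - 2 * p') / (p' * (1 - p')) := by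
    rw [hc]
    field_simp
    ring
  refine ⟨?_, ?_, ?_⟩
  · rw [hwp, hwm, if_pos hf1, if_pos hf1, one_div_div, one_div_div, hZp, hZm, hc']
    field_simp
    ring
  · rw [hc']
    exact div_pos (mul_pos (by linarith) (by linarith)) (mul_pos hq hq1)
  · rw [hc', div_lt_one (mul_pos hq hq1)]
    exact mul_lt_mul'' (by linarith) (by linarith) (by linarith) (by linarith)
end

section
/- Fix reals 0 < p < p' < 1/2 and T ≥ 2. Let N be a finite set of functions from a set X to ℝ, let w : N → (0,1] with Σ_{f∈N} w(f) = 1, let f0 : X → ℝ, and let f1 ∈ N satisfy sup_{x∈X}|f1(x) − f0(x)| ≤ 1/T². Fix x ∈ X and let m ∈ ℝ be a weighted median of f ↦ f(x) under w, i.e. Σ_{f : f(x) ≥ m} w(f) ≥ 1/2 and Σ_{f : f(x) ≤ m} w(f) ≥ 1/2, and suppose |f0(x) − m| > 2/T. Draw y uniformly at random from [m − 1/T, m + 1/T]; independently, let σ = sign(y − f0(x)) with probability 1−p and σ = −sign(y − f0(x)) with probability p; set ŵ(f) = p'·w(f) if σ·(y − f(x)) < 0 and ŵ(f) = (1−p')·w(f)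 otherwise, and w'(f) = ŵ(f)/Σ_{g∈N} ŵ(g). Then E[1/w'(f1)] ≤ (1 − c/4)/w(f1), where c = (p' − p)·[(1−p')/p' − p'/(1−p')]. -/
open MeasureTheory
open scoped Classical

/-- A nonnegative function on `[m - d, m + d]` bounded a.e. by `a`, and by `a - b` on a subset
filling half of the interval, has average at most `a - b / 2`. -/
theorem average_Icc_le_sub_half {F : ℝ → ℝ} {S : Set ℝ} {m d a b : ℝ} (hd : 0 < d)
    (hS : MeasurableSet S) (hvol : volume.real (S ∩ Set.Icc (m - d) (m + d)) = d)
    (hF0 : ∀ y ∈ Set.Icc (m - d) (m + d), 0 ≤ F y)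
    (hF : ∀ᵐ y, y ∈ Set.Icc (m - d) (m + d) → F y ≤ a - S.indicator (fun _ => b) y) :
    ⨍ y in Set.Icc (m - d) (m + d), F y ≤ a - b / 2 := by
  have hind : IntegrableOn (S.indicator fun _ => b) (Set.Icc (m - d) (m + d)) :=
    (integrableOn_const (by simp)).indicator hS
  have hconst : IntegrableOn (fun _ : ℝ => a) (Set.Icc (m - d) (m + d)) :=
    integrableOn_const (by simp)
  have hmono : ∫ y in Set.Icc (m - d) (m + d), F y
      ≤ ∫ y in Set.Icc (m - d) (m + d), (a - S.indicator (fun _ => b) y) :=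
    integral_mono_of_nonneg (ae_restrict_of_forall_mem measurableSet_Icc hF0)
      (hconst.sub hind) ((ae_restrict_iff' measurableSet_Icc).2 hF)
  have hlen : volume.real (Set.Icc (m - d) (m + d)) = 2 * d := by
    rw [Real.volume_real_Icc_of_le (by linarith)]; ring
  rw [integral_sub hconst hind, integral_indicator_const b hS,
    measureReal_restrict_apply hS, hvol, setIntegral_const, hlen] at hmono
  rw [setAverage_eq, hlen, smul_eq_mul, inv_mul_le_iff₀ (by positivity)]
  simp only [smul_eq_mul] at hmono
  linarith

theorem volume_real_Ioi_inter_Icc {m d : ℝ} (hd : 0 < d) :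
    volume.real (Set.Ioi m ∩ Set.Icc (m - d) (m + d)) = d := by
  have h : Set.Ioi m ∩ Set.Icc (m - d) (m + d) = Set.Ioc m (m + d) := by
    ext y
    simp only [Set.mem_inter_iff, Set.mem_Ioi, Set.mem_Icc, Set.mem_Ioc]
    constructor
    · rintro ⟨h1, -, h3⟩
      exact ⟨h1, h3⟩
    · rintro ⟨h1, h2⟩
      exact ⟨h1, by linarith, h2⟩
  rw [h, Real.volume_real_Ioc_of_le (by linarith)]
  ring

theorem volume_real_Iio_inter_Icc {m d : ℝ} (hd : 0 < d) :
    volume.real (Set.Iio m ∩ Set.Icc (m - d) (m + d)) = d := by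
  have h : Set.Iio m ∩ Set.Icc (m - d) (m + d) = Set.Ico (m - d) m := by
    ext y
    simp only [Set.mem_inter_iff, Set.mem_Iio, Set.mem_Icc, Set.mem_Ico]
    constructor
    · rintro ⟨h1, h2, -⟩
      exact ⟨h2, h1⟩
    · rintro ⟨h1, h2⟩
      exact ⟨h2, h1, by linarith⟩
  rw [h, Real.volume_real_Ico_of_le (by linarith)]
  ring

/-- Total weight after multiplying by `α` on the filtered part and by `β` elsewhere. -/
theorem sum_ite_mul_eq {ι : Type*} (N : Finset ι) (w : ι → ℝ) (P : ι → Prop) [DecidablePred P]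
    (hsum : ∑ f ∈ N, w f = 1) (α β : ℝ) :
    ∑ f ∈ N, (if P f then α * w f else β * w f)
      = α * (∑ f ∈ N with P f, w f) + β * (1 - ∑ f ∈ N with P f, w f) := by
  rw [Finset.sum_ite, ← Finset.mul_sum, ← Finset.mul_sum, ← hsum,
    ← Finset.sum_filter_add_sum_filter_not N P w]
  ring

/-- The feedback-averaged reciprocal weight of an element `i` classified like the truth, where the
truthful feedback `P` puts total weight `∑ f ∈ N with P f, w f` on the penalised side. -/
theorem expected_reciprocal_weight {ι : Type*} (N : Finset ι) (w : ι → ℝ) (P Q : ι → Prop)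
    [DecidablePred P] [DecidablePred Q] (hsum : ∑ f ∈ N, w f = 1) {p q : ℝ} (hq : 0 < q)
    (hq1 : q < 1) {i : ι} (hwi : 0 < w i) (hPi : ¬ P i) (hQi : Q i)
    (hQP : ∀ f ∈ N, Q f ↔ ¬ P f) :
    (1 - p) * ((∑ g ∈ N, if P g then q * w g else (1 - q) * w g)
          / (if P i then q * w i else (1 - q) * w i))
        + p * ((∑ g ∈ N, if Q g then q * w g else (1 - q) * w g)
          / (if Q i then q * w i else (1 - q) * w i))
      = (1 - (q - p) * ((1 - q) / q - q / (1 - q)) * ∑ f ∈ N with P f, w f) / w i := by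
  have hQsum : ∑ f ∈ N with Q f, w f = 1 - ∑ f ∈ N with P f, w f := by
    rw [Finset.filter_congr hQP, ← hsum, ← Finset.sum_filter_add_sum_filter_not N P w]
    ring
  rw [sum_ite_mul_eq N w P hsum, sum_ite_mul_eq N w Q hsum, if_neg hPi, if_pos hQi, hQsum]
  have : 1 - q ≠ 0 := by linarith
  field_simp
  ring

theorem stmt11 {X : Type*} (p p' T : ℝ)
    (hp : 0 < p) (hpp' : p < p') (hp' : p' < 1/2) (hT : 2 ≤ T)
    (N : Finset (X → ℝ)) (w : (X → ℝ) → ℝ)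
    (hw : ∀ f ∈ N, 0 < w f ∧ w f ≤ 1) (hsum : ∑ f ∈ N, w f = 1)
    (f0 f1 : X → ℝ) (hf1 : f1 ∈ N)
    (hclose : ∀ x' : X, |f1 x' - f0 x'| ≤ 1 / T ^ 2)
    (x : X) (m : ℝ)
    (hm1 : (1:ℝ)/2 ≤ ∑ f ∈ N.filter (fun f => m ≤ f x), w f)
    (hm2 : (1:ℝ)/2 ≤ ∑ f ∈ N.filter (fun f => f x ≤ m), w f)
    (hfar : 2 / T < |f0 x - m|)
    (c : ℝ) (hc : c = (p' - p) * ((1 - p') / p' - p' / (1 - p')))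
    (hatw : ℝ → ℝ → (X → ℝ) → ℝ)
    (hhatw : ∀ (y σ : ℝ) (f : X → ℝ),
      hatw y σ f = if σ * (y - f x) < 0 then p' * w f else (1 - p') * w f) :
    ⨍ y in Set.Icc (m - 1/T) (m + 1/T),
        ((1 - p) * ((∑ g ∈ N, hatw y (Real.sign (y - f0 x)) g)
            / hatw y (Real.sign (y - f0 x)) f1)
          + p * ((∑ g ∈ N, hatw y (-Real.sign (y - f0 x)) g)
            / hatw y (-Real.sign (y - f0 x)) f1))
      ≤ (1 - c/4) / w f1 := by
  have hT0 : 0 < T := by linarith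
  have hd : 0 < 1 / T := by positivity
  have hq0 : 0 < p' := hp.trans hpp'
  have hw1 : 0 < w f1 := (hw f1 hf1).1
  have hc0 : 0 ≤ c := by
    have : p' / (1 - p') ≤ (1 - p') / p' :=
      (div_le_div_iff₀ (by linarith) hq0).2 (by nlinarith)
    rw [hc]
    exact mul_nonneg (by linarith) (by linarith)
  have hclose1 := abs_le.1 (hclose x)
  have hsq : 1 / T ^ 2 ≤ 1 / T := one_div_le_one_div_of_le hT0 (by nlinarith)
  have h2T : 2 / T = 1 / T + 1 / T := by ring
  have hhat0 : ∀ (y σ : ℝ), ∀ f ∈ N, 0 ≤ hatw y σ f := by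
    intro y σ f hf
    have := (hw f hf).1
    rw [hhatw]
    split_ifs
    · positivity
    · exact mul_nonneg (by linarith) this.le
  have hF0 : ∀ y : ℝ, 0 ≤ (1 - p) * ((∑ g ∈ N, hatw y (Real.sign (y - f0 x)) g)
            / hatw y (Real.sign (y - f0 x)) f1)
          + p * ((∑ g ∈ N, hatw y (-Real.sign (y - f0 x)) g)
            / hatw y (-Real.sign (y - f0 x)) f1) := fun y =>
    add_nonneg
      (mul_nonneg (by linarith)
        (div_nonneg (Finset.sum_nonneg (hhat0 _ _)) (hhat0 _ _ _ hf1)))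
      (mul_nonneg hp.le (div_nonneg (Finset.sum_nonneg (hhat0 _ _)) (hhat0 _ _ _ hf1)))
  have hae : ∀ᵐ y : ℝ, ∀ f ∈ N, y ≠ f x := by
    filter_upwards [(N.image fun f => f x).countable_toSet.ae_notMem volume] with y hy f hf h
    exact hy (by simpa using ⟨f, hf, h.symm⟩)
  have hbound : ∀ {y : ℝ} {S : Set ℝ} (s : ℝ), s ≠ 0 → 0 < s * (y - f1 x) →
      (∀ f ∈ N, y ≠ f x) →
      (y ∈ S → (1:ℝ)/2 ≤ ∑ f ∈ N with s * (y - f x) < 0, w f) →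
      (1 - p) * ((∑ g ∈ N, hatw y s g) / hatw y s f1)
          + p * ((∑ g ∈ N, hatw y (-s) g) / hatw y (-s) f1)
        ≤ 1 / w f1 - S.indicator (fun _ => c / 2 / w f1) y := by
    intro y S s hs hs1 hy hS
    simp only [hhatw]
    rw [expected_reciprocal_weight N w (fun f => s * (y - f x) < 0)
      (fun f => -s * (y - f x) < 0) hsum hq0 (by linarith) hw1 (not_lt.2 hs1.le)
      (by linarith), ← hc]
    · by_cases hyS : y ∈ S
      · rw [Set.indicator_of_mem hyS, ← sub_div]
        gcongr
        nlinarith [hS hyS]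
      · rw [Set.indicator_of_notMem hyS, sub_zero]
        gcongr
        have : 0 ≤ ∑ f ∈ N with s * (y - f x) < 0, w f :=
          Finset.sum_nonneg fun f hf => (hw f (Finset.mem_filter.1 hf).1).1.le
        nlinarith
    · intro f hf
      have : s * (y - f x) ≠ 0 := mul_ne_zero hs (sub_ne_zero.2 (hy f hf))
      rw [neg_mul, neg_lt_zero, not_lt, this.symm.le_iff_lt]
  have hsubset : ∀ {P Q : (X → ℝ) → Prop}, (∀ f ∈ N, P f → Q f) →
      (1:ℝ)/2 ≤ ∑ f ∈ N with P f, w f → (1:ℝ)/2 ≤ ∑ f ∈ N with Q f, w f := by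
    intro P Q hPQ h
    refine h.trans (Finset.sum_le_sum_of_subset_of_nonneg ?_ ?_)
    · intro f hf
      rw [Finset.mem_filter] at hf ⊢
      exact ⟨hf.1, hPQ f hf.1 hf.2⟩
    · exact fun f hf _ => (hw f (Finset.mem_filter.1 hf).1).1.le
  rw [show (1 - c / 4) / w f1 = 1 / w f1 - c / 2 / w f1 / 2 by ring]
  rcases lt_abs.1 hfar with h | h
  · refine average_Icc_le_sub_half hd measurableSet_Ioi (volume_real_Ioi_inter_Icc hd)
      (fun y _ => hF0 y) ?_
    filter_upwards [hae] with y hy hyI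
    rw [Real.sign_of_neg (by linarith [hyI.2])]
    refine hbound (-1) (by norm_num) (by linarith [hyI.2]) hy fun hym => hsubset ?_ hm2
    intro f _ hfm
    linarith [Set.mem_Ioi.1 hym]
  · refine average_Icc_le_sub_half hd measurableSet_Iio (volume_real_Iio_inter_Icc hd)
      (fun y _ => hF0 y) ?_
    filter_upwards [hae] with y hy hyI
    rw [Real.sign_of_pos (by linarith [hyI.1])]
    refine hbound 1 (by norm_num) (by linarith [hyI.1]) hy fun hym => hsubset ?_ hm1
    intro f _ hfm
    linarith [Set.mem_Iio.1 hym]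
end

section
/- Fix p ∈ [0, 1/2). Let X be a set and ℋ a nonempty class of functions X → [0,1], with loss ℓ(y, y') = |y − y'| and d_∞(f, g) = sup_{x∈X}|f(x) − g(x)|, and suppose the covering dimension d = Cdim(ℋ) is finite. Then there exist a constant C depending only on p and a randomized learning strategy with the following guarantee: for every hidden f0 ∈ ℋ, every horizon T ≥ 2, and every adaptively chosen sequence x_1, …, x_T ∈ X, where in each round the learner outputs y_t and observes σ_t equal to sign(y_t − f0(x_t)) with probability 1−p and to −sign(y_t − f0(x_t)) with probability p (independently across rounds), the expected total loss satisfies E[Σ_{t=1}^T |y_t − f0(x_t)|] ≤ C·d·log T. -/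
open scoped Classical

/-- Expected total symmetric loss of a randomized strategy `strat` over `T` rounds in the
noisy binary feedback model: each round the true sign feedback `decide (f0 x < y)` is
flipped independently with probability `p` before being shown to the learner.  Contexts are
chosen by an adaptive adversary `adv`, and the hidden function is `f0`. -/
noncomputable def expLossNoisy {X : Type*} (p : ℝ) (strat : Hist X → X → PMF ℝ)
    (adv : Hist X → X) (f0 : X → ℝ) : ℕ → Hist X → ℝ
  | 0, _ => 0
  | T + 1, h =>
    ∑' y : ℝ, ((strat h (adv h)) y).toReal *
      (|y - f0 (adv h)| +
        (1 - p) * expLossNoisy p strat adv f0 T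
          (h ++ [(adv h, y, decide (f0 (adv h) < y))]) +
        p * expLossNoisy p strat adv f0 T
          (h ++ [(adv h, y, ! decide (f0 (adv h) < y))]))

/-- Expectation of a real function under the push-forward of a distribution on a finite type. -/
lemma PMF.tsum_map_toReal_mul {ι β : Type*} [Fintype ι] (q : PMF ι) (u : ι → β) (F : β → ℝ) :
    ∑' y : β, ((q.map u) y).toReal * F y = ∑ i, (q i).toReal * F (u i) := by
  have hterm : ∀ y : β, ((q.map u) y).toReal * F y =
      ∑ i, if y = u i then (q i).toReal * F (u i) else 0 := by
    intro y
    rw [PMF.map_apply, tsum_fintype, ENNReal.toReal_sum, Finset.sum_mul]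
    · refine Finset.sum_congr rfl fun i _ => ?_
      split_ifs with h
      · rw [h]
      · simp
    · intro i _
      split_ifs
      · exact q.apply_ne_top i
      · simp
  simp_rw [hterm]
  rw [Summable.tsum_finsetSum]
  · exact Finset.sum_congr rfl fun i _ => tsum_ite_eq (u i) _
  · exact fun i _ => (hasSum_ite_eq (u i) _).summable

/-- A finite family of values with nonnegative weights has a weighted median. -/
lemma exists_weighted_median {α : Type*} (G : Finset α) (hG : G.Nonempty) (w v : α → ℝ)
    (hw : ∀ g ∈ G, 0 ≤ w g) :
    ∃ m : ℝ, (∃ g ∈ G, m = v g) ∧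
      (∑ g ∈ G, w g) / 2 ≤ ∑ g ∈ G with v g ≤ m, w g ∧
      (∑ g ∈ G, w g) / 2 ≤ ∑ g ∈ G with m ≤ v g, w g := by
  have hW : 0 ≤ ∑ g ∈ G, w g := Finset.sum_nonneg hw
  set P := G.filter fun a => (∑ g ∈ G, w g) / 2 ≤ ∑ g ∈ G with v g ≤ v a, w g
  have hPne : P.Nonempty := by
    obtain ⟨a, ha, hmax⟩ := G.exists_max_image v hG
    refine ⟨a, Finset.mem_filter.2 ⟨ha, ?_⟩⟩
    rw [Finset.filter_true_of_mem hmax]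
    linarith
  obtain ⟨a, ha, hmin⟩ := P.exists_min_image v hPne
  obtain ⟨haG, hale⟩ := Finset.mem_filter.1 ha
  refine ⟨v a, ⟨a, haG, rfl⟩, hale, ?_⟩
  have hsplit : ∑ g ∈ G with v a ≤ v g, w g + ∑ g ∈ G with v g < v a, w g = ∑ g ∈ G, w g := by
    rw [← Finset.sum_filter_add_sum_filter_not G (fun g => v a ≤ v g)]
    simp only [not_le]
  have hlt : ∑ g ∈ G with v g < v a, w g ≤ (∑ g ∈ G, w g) / 2 := by
    rcases (G.filter fun g => v g < v a).eq_empty_or_nonempty with he | hne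
    · rw [he, Finset.sum_empty]
      linarith
    · obtain ⟨b, hb, hbmax⟩ := Finset.exists_max_image _ v hne
      obtain ⟨hbG, hba⟩ := Finset.mem_filter.1 hb
      have hbP : b ∉ P := fun h => absurd (hmin b h) (not_le.2 hba)
      have hblt : ∑ g ∈ G with v g ≤ v b, w g < (∑ g ∈ G, w g) / 2 := by
        by_contra hcon
        exact hbP (Finset.mem_filter.2 ⟨hbG, not_lt.1 hcon⟩)
      refine le_trans (Finset.sum_le_sum_of_subset_of_nonneg ?_ ?_) hblt.le
      · intro g hg
        exact Finset.mem_filter.2 ⟨(Finset.mem_filter.1 hg).1, hbmax g hg⟩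
      · exact fun g hg _ => hw g (Finset.mem_filter.1 hg).1
  linarith

/-- Multiplicative update of the weight of the expert `g` after one round. -/
noncomputable def expertFactor {X : Type*} (η : ℝ) (g : X → ℝ) (r : X × ℝ × Bool) : ℝ :=
  if decide (g r.1 < r.2.1) = r.2.2 then 1 + η else 1 - η

/-- Weight of the expert `g` after the history `l`. -/
noncomputable def expertWeight {X : Type*} (η : ℝ) (g : X → ℝ) (l : Hist X) : ℝ :=
  (l.map (expertFactor η g)).prod

/-- Logarithm of the inverse of the normalized weight of the expert `g` within `G`. -/
noncomputable def expertPotential {X : Type*} (η : ℝ) (G : Finset (X → ℝ)) (g : X → ℝ)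
    (l : Hist X) : ℝ :=
  Real.log (∑ g' ∈ G, expertWeight η g' l) - Real.log (expertWeight η g l)

/-- A median of the predictions of the experts in `G` at `x`, weighted after the history `l`. -/
noncomputable def expertMedian {X : Type*} (η : ℝ) (G : Finset (X → ℝ)) (l : Hist X) (x : X) : ℝ :=
  Classical.epsilon fun m : ℝ => (∃ g ∈ G, m = g x) ∧
    (∑ g ∈ G, expertWeight η g l) / 2 ≤ ∑ g ∈ G with g x ≤ m, expertWeight η g l ∧
    (∑ g ∈ G, expertWeight η g l) / 2 ≤ ∑ g ∈ G with m ≤ g x, expertWeight η g l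

section Experts

variable {X : Type*} {η : ℝ}

lemma expertWeight_append (g : X → ℝ) (l : Hist X) (r : X × ℝ × Bool) :
    expertWeight η g (l ++ [r]) = expertWeight η g l * expertFactor η g r := by
  simp [expertWeight]

lemma expertFactor_le (h0 : 0 < η) (g : X → ℝ) (r : X × ℝ × Bool) :
    expertFactor η g r ≤ 1 + η := by
  unfold expertFactor
  split_ifs <;> linarith

lemma le_expertFactor (h0 : 0 < η) (g : X → ℝ) (r : X × ℝ × Bool) :
    1 - η ≤ expertFactor η g r := by
  unfold expertFactor
  split_ifs <;> linarith

lemma expertWeight_pos (h0 : 0 < η) (h1 : η < 1) (g : X → ℝ) (l : Hist X) :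
    0 < expertWeight η g l := by
  unfold expertWeight
  refine List.prod_pos fun a ha => ?_
  obtain ⟨r, -, rfl⟩ := List.mem_map.1 ha
  linarith [le_expertFactor h0 g r]

lemma sum_expertWeight_pos (h0 : 0 < η) (h1 : η < 1) {G : Finset (X → ℝ)} (hG : G.Nonempty)
    (l : Hist X) : 0 < ∑ g ∈ G, expertWeight η g l :=
  Finset.sum_pos (fun g _ => expertWeight_pos h0 h1 g l) hG

lemma expertMedian_spec (h0 : 0 < η) (h1 : η < 1) {G : Finset (X → ℝ)} (hG : G.Nonempty)
    (l : Hist X) (x : X) :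
    (∃ g ∈ G, expertMedian η G l x = g x) ∧
      (∑ g ∈ G, expertWeight η g l) / 2 ≤
        ∑ g ∈ G with g x ≤ expertMedian η G l x, expertWeight η g l ∧
      (∑ g ∈ G, expertWeight η g l) / 2 ≤
        ∑ g ∈ G with expertMedian η G l x ≤ g x, expertWeight η g l :=
  Classical.epsilon_spec (exists_weighted_median G hG (fun g => expertWeight η g l)
    (fun g => g x) fun g _ => (expertWeight_pos h0 h1 g l).le)

lemma expertPotential_nil (G : Finset (X → ℝ)) (g : X → ℝ) :
    expertPotential η G g [] = Real.log (G.card : ℝ) := by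
  simp [expertPotential, expertWeight]

lemma expertPotential_nonneg (h0 : 0 < η) (h1 : η < 1) {G : Finset (X → ℝ)} {g : X → ℝ}
    (hg : g ∈ G) (l : Hist X) : 0 ≤ expertPotential η G g l := by
  unfold expertPotential
  rw [sub_nonneg]
  refine Real.log_le_log (expertWeight_pos h0 h1 g l) ?_
  exact Finset.single_le_sum (f := fun g' => expertWeight η g' l)
    (fun g' _ => (expertWeight_pos h0 h1 g' l).le) hg

lemma expertPotential_append (h0 : 0 < η) (h1 : η < 1) {G : Finset (X → ℝ)} {g : X → ℝ}
    (hg : g ∈ G) (l : Hist X) (r : X × ℝ × Bool) :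
    expertPotential η G g (l ++ [r]) ≤ expertPotential η G g l +
      ((∑ g' ∈ G, expertWeight η g' (l ++ [r])) /
        ((∑ g' ∈ G, expertWeight η g' l) * expertFactor η g r) - 1) := by
  have hW := sum_expertWeight_pos h0 h1 ⟨g, hg⟩ l
  have hW' := sum_expertWeight_pos h0 h1 ⟨g, hg⟩ (l ++ [r])
  have hw := expertWeight_pos h0 h1 g l
  have hf : 0 < expertFactor η g r := by linarith [le_expertFactor h0 g r]
  have key := Real.log_le_sub_one_of_pos (div_pos hW' (mul_pos hW hf))
  rw [Real.log_div hW'.ne' (mul_pos hW hf).ne', Real.log_mul hW.ne' hf.ne'] at key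
  unfold expertPotential
  rw [expertWeight_append g, Real.log_mul hw.ne' hf.ne']
  linarith

lemma expertPotential_append_le (h0 : 0 < η) (h1 : η ≤ 1 / 2) {G : Finset (X → ℝ)} {g : X → ℝ}
    (hg : g ∈ G) (l : Hist X) (r : X × ℝ × Bool) :
    expertPotential η G g (l ++ [r]) ≤ expertPotential η G g l + 2 := by
  have h1' : η < 1 := by linarith
  have hW := sum_expertWeight_pos h0 h1' ⟨g, hg⟩ l
  have hf := le_expertFactor h0 g r
  have hf0 : 0 < expertFactor η g r := by linarith
  have key := expertPotential_append h0 h1' hg l r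
  have hW' : ∑ g' ∈ G, expertWeight η g' (l ++ [r]) ≤
      3 * ((∑ g' ∈ G, expertWeight η g' l) * expertFactor η g r) := by
    rw [Finset.sum_mul, Finset.mul_sum]
    refine Finset.sum_le_sum fun g' _ => ?_
    rw [expertWeight_append]
    have := expertWeight_pos h0 h1' g' l
    have := expertFactor_le h0 g' r
    nlinarith
  rw [← div_le_iff₀ (mul_pos hW hf0)] at hW'
  linarith

lemma sum_expertWeight_append (G : Finset (X → ℝ)) (l : Hist X) (x : X) (y : ℝ) (b : Bool) :
    ∑ g ∈ G, expertWeight η g (l ++ [(x, y, b)]) =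
      (1 + η) * ∑ g ∈ G, expertWeight η g l -
        2 * η * ∑ g ∈ G with decide (g x < y) = !b, expertWeight η g l := by
  rw [Finset.sum_filter, Finset.mul_sum, Finset.mul_sum, ← Finset.sum_sub_distrib]
  refine Finset.sum_congr rfl fun g _ => ?_
  rw [expertWeight_append]
  cases b <;> by_cases h : g x < y <;> simp [expertFactor, h] <;> ring

lemma sum_expertWeight_append_not (G : Finset (X → ℝ)) (l : Hist X) (x : X) (y : ℝ) (b : Bool) :
    ∑ g ∈ G, expertWeight η g (l ++ [(x, y, !b)]) =
      (1 - η) * ∑ g ∈ G, expertWeight η g l +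
        2 * η * ∑ g ∈ G with decide (g x < y) = !b, expertWeight η g l := by
  rw [Finset.sum_filter, Finset.mul_sum, Finset.mul_sum, ← Finset.sum_add_distrib]
  refine Finset.sum_congr rfl fun g _ => ?_
  rw [expertWeight_append]
  cases b <;> by_cases h : g x < y <;> simp [expertFactor, h] <;> ring

/-- If the expert `g` gives the correct answer `b` to the query `y`, its expected potential drops
proportionally to the weight of the experts that give the incorrect one. -/
lemma expertPotential_drift (h0 : 0 < η) (h1 : η ≤ 1 / 2) {p : ℝ} (hp0 : 0 ≤ p)
    (hp : η = (1 - 2 * p) / 2) {G : Finset (X → ℝ)} {g : X → ℝ}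
    (hg : g ∈ G) (l : Hist X) (x : X) (y : ℝ) (b : Bool) (hb : decide (g x < y) = b) (c : ℝ)
    (hc : c * ∑ g' ∈ G, expertWeight η g' l ≤
      ∑ g' ∈ G with decide (g' x < y) = !b, expertWeight η g' l) :
    (1 - p) * expertPotential η G g (l ++ [(x, y, b)]) +
      p * expertPotential η G g (l ++ [(x, y, !b)]) ≤
        expertPotential η G g l - 2 * η ^ 2 * c := by
  have h1' : η < 1 := by linarith
  have hW := sum_expertWeight_pos h0 h1' ⟨g, hg⟩ l
  have k1 := expertPotential_append h0 h1' hg l (x, y, b)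
  have k2 := expertPotential_append h0 h1' hg l (x, y, !b)
  have f1 : expertFactor η g (x, y, b) = 1 + η := by simp [expertFactor, hb]
  have f2 : expertFactor η g (x, y, !b) = 1 - η := by simp [expertFactor, hb]
  have hIn : 0 ≤ ∑ g' ∈ G with decide (g' x < y) = !b, expertWeight η g' l :=
    Finset.sum_nonneg fun g' _ => (expertWeight_pos h0 h1' g' l).le
  rw [sum_expertWeight_append, f1] at k1
  rw [sum_expertWeight_append_not, f2] at k2
  set W := ∑ g' ∈ G, expertWeight η g' l
  set I := ∑ g' ∈ G with decide (g' x < y) = !b, expertWeight η g' l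
  set Φ := expertPotential η G g l
  have e1 : ((1 + η) * W - 2 * η * I) / (W * (1 + η)) - 1 = -(2 * η / (1 + η)) * (I / W) := by
    have : 1 + η ≠ 0 := by linarith
    field_simp
    ring
  have e2 : ((1 - η) * W + 2 * η * I) / (W * (1 - η)) - 1 = (2 * η / (1 - η)) * (I / W) := by
    have : 1 - η ≠ 0 := by linarith
    field_simp
    ring
  rw [e1] at k1
  rw [e2] at k2
  have hq : c ≤ I / W := (le_div_iff₀ hW).2 hc
  have hq0 : 0 ≤ I / W := div_nonneg hIn hW.le
  set q := I / W
  have hcoef : (1 - p) * -(2 * η / (1 + η)) + p * (2 * η / (1 - η)) ≤ -(2 * η ^ 2) := by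
    have hpe : p = (1 - 2 * η) / 2 := by linarith
    have e3 : (1 - p) * -(2 * η / (1 + η)) + p * (2 * η / (1 - η)) =
        -(2 * η ^ 2) / ((1 + η) * (1 - η)) := by
      have : 1 - η ≠ 0 := by linarith
      have : 1 + η ≠ 0 := by linarith
      rw [hpe]
      field_simp
      ring
    have hpos : 0 < (1 + η) * (1 - η) := mul_pos (by linarith) (by linarith)
    rw [e3, div_le_iff₀ hpos]
    nlinarith [pow_pos h0 4]
  have k1' := mul_le_mul_of_nonneg_left k1 (by linarith : (0:ℝ) ≤ 1 - p)
  have k2' := mul_le_mul_of_nonneg_left k2 hp0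
  have k3 := mul_le_mul_of_nonneg_right hcoef hq0
  have k4 : 2 * η ^ 2 * c ≤ 2 * η ^ 2 * q := mul_le_mul_of_nonneg_left hq (by positivity)
  linarith

end Experts

/-- The symmetric integer offsets `±1, …, ±(M + 1)`. -/
def symOffset {M : ℕ} (i : Fin (M + 1) × Bool) : ℤ :=
  if i.2 then (i.1 : ℤ) + 1 else -((i.1 : ℤ) + 1)

lemma symOffset_injective {M : ℕ} : Function.Injective (symOffset (M := M)) := by
  rintro ⟨a, b⟩ ⟨a', b'⟩ h
  cases b <;> cases b' <;> simp [symOffset] at h ⊢ <;> omega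

lemma abs_symOffset_le {M : ℕ} (i : Fin (M + 1) × Bool) : |(symOffset i : ℝ)| ≤ (M : ℝ) + 1 := by
  have : |symOffset i| ≤ (M : ℤ) + 1 := by
    obtain ⟨a, b⟩ := i
    have := a.2
    cases b <;> simp only [symOffset] <;> rw [abs_le] <;> constructor <;> simp <;> omega
  exact_mod_cast this

/-- Query points: uniformly random offsets of the weighted median by multiples of `s`. -/
noncomputable def expertQuery {X : Type*} (η s : ℝ) (M : ℕ) (G : Finset (X → ℝ)) (l : Hist X)
    (x : X) (i : Fin (M + 1) × Bool) : ℝ :=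
  expertMedian η G l x + symOffset i * s

/-- At most one query point is ambiguous. -/
lemma card_ambiguous_le_one {M : ℕ} (m s ε v : ℝ) (hs : 2 * ε < s) :
    ((Finset.univ : Finset (Fin (M + 1) × Bool)).filter
      fun i => |m + symOffset i * s - v| ≤ ε).card ≤ 1 := by
  rw [Finset.card_le_one]
  intro i hi j hj
  simp only [Finset.mem_filter, Finset.mem_univ, true_and] at hi hj
  by_contra hne
  have hz : symOffset i ≠ symOffset j := fun h => hne (symOffset_injective h)
  have h0 : 0 ≤ ε := (abs_nonneg _).trans hi
  rw [abs_le] at hi hj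
  rcases lt_or_gt_of_ne hz with h | h
  · have : (symOffset i : ℝ) + 1 ≤ symOffset j := by exact_mod_cast h
    nlinarith
  · have : (symOffset j : ℝ) + 1 ≤ symOffset i := by exact_mod_cast h
    nlinarith

/-- The expected loss of a round is controlled by the expected drop of the potential. -/
lemma expertQuery_round {X : Type*} {η : ℝ} (h0 : 0 < η) (h1 : η ≤ 1 / 2) {p : ℝ} (hp0 : 0 ≤ p)
    (hp : η = (1 - 2 * p) / 2) {G : Finset (X → ℝ)} {g f0 : X → ℝ} (hg : g ∈ G) (l : Hist X)
    (x : X) {ε s : ℝ} (M : ℕ) (hs : 2 * ε < s) (hε : |f0 x - g x| ≤ ε)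
    (hf0 : f0 x ∈ Set.Icc (0:ℝ) 1) (hG : ∀ g' ∈ G, g' x ∈ Set.Icc (0:ℝ) 1) :
    ∑ i : Fin (M + 1) × Bool, (|expertQuery η s M G l x i - f0 x| + 2 / η ^ 2 *
      ((1 - p) * expertPotential η G g
          (l ++ [(x, expertQuery η s M G l x i, decide (f0 x < expertQuery η s M G l x i))]) +
        p * expertPotential η G g
          (l ++ [(x, expertQuery η s M G l x i, ! decide (f0 x < expertQuery η s M G l x i))]))) ≤
      2 * ((M : ℝ) + 1) * (2 / η ^ 2 * expertPotential η G g l + 3 * ((M : ℝ) + 1) * s) +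
        2 / η ^ 2 * 2 := by
  have h1' : η < 1 := by linarith
  have hε0 : 0 ≤ ε := (abs_nonneg _).trans hε
  have hs0 : 0 < s := by linarith
  obtain ⟨⟨gm, hgm, hm⟩, hlow, hhigh⟩ := expertMedian_spec h0 h1' ⟨g, hg⟩ l x
  have hm01 := hG gm hgm
  rw [← hm] at hm01
  set m := expertMedian η G l x
  set Φ := expertPotential η G g l
  set n : ℝ := (M : ℝ) + 1 with hn
  have hn1 : 1 ≤ n := by rw [hn]; linarith [(Nat.cast_nonneg M : (0:ℝ) ≤ M)]
  have hA : 0 < 2 / η ^ 2 := by positivity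
  set y : Fin (M + 1) × Bool → ℝ := expertQuery η s M G l x
  have hyi : ∀ i, y i = m + symOffset i * s := fun i => rfl
  set Q : Fin (M + 1) × Bool → ℝ := fun i =>
    (1 - p) * expertPotential η G g (l ++ [(x, y i, decide (f0 x < y i))]) +
      p * expertPotential η G g (l ++ [(x, y i, ! decide (f0 x < y i))]) with hQ
  have hcard : (Fintype.card (Fin (M + 1) × Bool) : ℝ) = 2 * n := by
    simp [hn, mul_comm]
  have hloss : ∀ i, |y i - f0 x| ≤ |f0 x - m| + n * s := by
    intro i
    have := abs_symOffset_le i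
    have e : y i - f0 x = -(f0 x - m) + symOffset i * s := by rw [hyi]; ring
    rw [e]
    refine (abs_add_le _ _).trans ?_
    rw [abs_neg, abs_mul, abs_of_pos hs0]
    gcongr
  have hQ2 : ∀ i, Q i ≤ Φ + 2 := by
    intro i
    have a := expertPotential_append_le h0 h1 hg l (x, y i, decide (f0 x < y i))
    have b := expertPotential_append_le h0 h1 hg l (x, y i, ! decide (f0 x < y i))
    have a' := mul_le_mul_of_nonneg_left a (by linarith : (0:ℝ) ≤ 1 - p)
    have b' := mul_le_mul_of_nonneg_left b hp0
    simp only [hQ]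
    linarith
  have hsame : ∀ i, ¬ |y i - f0 x| ≤ ε → decide (g x < y i) = decide (f0 x < y i) := by
    intro i hi
    rw [decide_eq_decide]
    rw [abs_le] at hε
    rw [not_le] at hi
    constructor <;> intro <;> cases abs_cases (y i - f0 x) <;> linarith
  have hdrift : ∀ i, ∀ c : ℝ, ¬ |y i - f0 x| ≤ ε → c * ∑ g' ∈ G, expertWeight η g' l ≤
      ∑ g' ∈ G with decide (g' x < y i) = !decide (f0 x < y i), expertWeight η g' l →
      Q i ≤ Φ - 2 * η ^ 2 * c := fun i c hi hc =>
    expertPotential_drift h0 h1 hp0 hp hg l x (y i) _ (hsame i hi) c hc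
  have hQ0 : ∀ i, Q i ≤ Φ + if |y i - f0 x| ≤ ε then 2 else 0 := by
    intro i
    split_ifs with hi
    · exact hQ2 i
    · have := hdrift i 0 hi (by
        rw [zero_mul]
        exact Finset.sum_nonneg fun g' _ => (expertWeight_pos h0 h1' g' l).le)
      linarith
  have hamb : ∑ i, (if |y i - f0 x| ≤ ε then (2:ℝ) else 0) ≤ 2 := by
    rw [← Finset.sum_filter, Finset.sum_const, nsmul_eq_mul]
    have := card_ambiguous_le_one (M := M) m s ε (f0 x) hs
    have h' : ((Finset.univ.filter fun i => |y i - f0 x| ≤ ε).card : ℝ) ≤ 1 := by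
      exact_mod_cast this
    linarith
  have hsum : ∑ i, (|y i - f0 x| + 2 / η ^ 2 * Q i) =
      ∑ i, |y i - f0 x| + 2 / η ^ 2 * ∑ i, Q i := by
    rw [Finset.sum_add_distrib, Finset.mul_sum]
  have hsumloss : ∑ i, |y i - f0 x| ≤ 2 * n * (|f0 x - m| + n * s) := by
    refine (Finset.sum_le_card_nsmul _ _ _ fun i _ => hloss i).trans ?_
    rw [nsmul_eq_mul, Finset.card_univ, hcard]
  change ∑ i, (|y i - f0 x| + 2 / η ^ 2 * Q i) ≤ _
  rw [hsum]
  by_cases hfar : |f0 x - m| ≤ 2 * n * s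
  · have hsumQ : ∑ i, Q i ≤ 2 * n * Φ + 2 := by
      refine (Finset.sum_le_sum fun i _ => hQ0 i).trans ?_
      rw [Finset.sum_add_distrib, Finset.sum_const, nsmul_eq_mul, Finset.card_univ, hcard]
      linarith
    have := mul_le_mul_of_nonneg_left hsumQ hA.le
    have : 2 * n * (|f0 x - m| + n * s) ≤ 2 * n * (3 * n * s) := by
      refine mul_le_mul_of_nonneg_left ?_ (by linarith)
      linarith
    linarith
  · rw [not_le] at hfar
    have hns : s ≤ n * s := by nlinarith
    have hgain : ∃ b : Bool, ∀ i : Fin (M + 1) × Bool, i.2 = b → Q i ≤ Φ - η ^ 2 := by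
      have habs := fun i : Fin (M + 1) × Bool => abs_le.1 (abs_symOffset_le i)
      have hz1 : ∀ i : Fin (M + 1) × Bool, (symOffset i : ℝ) * s ≤ n * s := fun i =>
        mul_le_mul_of_nonneg_right (habs i).2 hs0.le
      have hz2 : ∀ i : Fin (M + 1) × Bool, -(n * s) ≤ (symOffset i : ℝ) * s := fun i => by
        have := mul_le_mul_of_nonneg_right (habs i).1 hs0.le
        linarith
      rcases le_abs.1 hfar.le with hpos | hneg
      · refine ⟨true, fun i hi => ?_⟩
        have hz : (0:ℝ) < symOffset i := by
          have : 0 < symOffset i := by simp only [symOffset, hi, if_true]; omega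
          exact_mod_cast this
        have hym : m < y i := by rw [hyi]; nlinarith
        have hyf : y i < f0 x - ε := by rw [hyi]; linarith [hz1 i]
        have hna : ¬ |y i - f0 x| ≤ ε := by
          intro h
          linarith [(abs_le.1 h).1]
        have hd : decide (f0 x < y i) = false := decide_eq_false (by linarith)
        have := hdrift i (1 / 2) hna (by
          rw [hd]
          refine le_trans (by linarith) (hlow.trans (Finset.sum_le_sum_of_subset_of_nonneg ?_ ?_))
          · intro g' hg'
            obtain ⟨hg1, hg2⟩ := Finset.mem_filter.1 hg'
            exact Finset.mem_filter.2 ⟨hg1, by simpa using hg2.trans_lt hym⟩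
          · exact fun g' _ _ => (expertWeight_pos h0 h1' g' l).le)
        linarith
      · refine ⟨false, fun i hi => ?_⟩
        have hz : (symOffset i : ℝ) < 0 := by
          have : symOffset i < 0 := by simp [symOffset, hi]; omega
          exact_mod_cast this
        have hym : y i < m := by rw [hyi]; nlinarith
        have hyf : f0 x + ε < y i := by rw [hyi]; linarith [hz2 i]
        have hna : ¬ |y i - f0 x| ≤ ε := by
          intro h
          linarith [(abs_le.1 h).2]
        have hd : decide (f0 x < y i) = true := decide_eq_true (by linarith)
        have := hdrift i (1 / 2) hna (by
          rw [hd]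
          refine le_trans (by linarith) (hhigh.trans (Finset.sum_le_sum_of_subset_of_nonneg ?_ ?_))
          · intro g' hg'
            obtain ⟨hg1, hg2⟩ := Finset.mem_filter.1 hg'
            exact Finset.mem_filter.2 ⟨hg1, by simpa using hym.le.trans hg2⟩
          · exact fun g' _ _ => (expertWeight_pos h0 h1' g' l).le)
        linarith
    obtain ⟨b, hb⟩ := hgain
    have hQb : ∀ i, Q i ≤ Φ + (if |y i - f0 x| ≤ ε then (2:ℝ) else 0) -
        if i.2 = b then η ^ 2 else 0 := by
      intro i
      by_cases hi : i.2 = b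
      · have := hb i hi
        rw [if_pos hi]
        split_ifs <;> linarith
      · rw [if_neg hi]
        linarith [hQ0 i]
    have hcb : ∑ i : Fin (M + 1) × Bool, (if i.2 = b then η ^ 2 else 0) = n * η ^ 2 := by
      rw [Fintype.sum_prod_type]
      cases b <;> simp [hn]
    have hsumQ : ∑ i, Q i ≤ 2 * n * Φ + 2 - n * η ^ 2 := by
      refine (Finset.sum_le_sum fun i _ => hQb i).trans ?_
      rw [Finset.sum_sub_distrib, Finset.sum_add_distrib, Finset.sum_const, nsmul_eq_mul,
        Finset.card_univ, hcard, hcb]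
      linarith
    have hQm := mul_le_mul_of_nonneg_left hsumQ hA.le
    have hAe : 2 / η ^ 2 * (n * η ^ 2) = 2 * n := by
      field_simp
    have habs1 : |f0 x - m| ≤ 1 := by
      rw [abs_le]
      constructor <;> linarith [hf0.1, hf0.2, hm01.1, hm01.2]
    have : 2 * n * (|f0 x - m| + n * s) ≤ 2 * n * (1 + 3 * n * s) := by
      refine mul_le_mul_of_nonneg_left ?_ (by linarith)
      nlinarith
    linarith

/-- The strategy that, in the epoch `k = ep t` of round `t`, queries the randomly perturbed weighted
median of the experts in `G k`, with weights computed from the rounds since `start k`. -/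
noncomputable def epochStrategy {X : Type*} (η : ℝ) (G : ℕ → Finset (X → ℝ)) (s : ℕ → ℝ)
    (M ep start : ℕ → ℕ) (h : Hist X) (x : X) : PMF ℝ :=
  (PMF.uniformOfFintype (Fin (M (ep h.length) + 1) × Bool)).map
    (expertQuery η (s (ep h.length)) (M (ep h.length)) (G (ep h.length))
      (h.drop (start (ep h.length))) x)

lemma expLossNoisy_epochStrategy_le {X : Type*} {η : ℝ} (h0 : 0 < η) (h1 : η ≤ 1 / 2) {p : ℝ}
    (hp0 : 0 ≤ p) (hp : η = (1 - 2 * p) / 2) {G : ℕ → Finset (X → ℝ)} {g : ℕ → X → ℝ}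
    {f0 : X → ℝ} {ε s : ℕ → ℝ} {M ep start : ℕ → ℕ} (hg : ∀ k, g k ∈ G k)
    (hs : ∀ k, 2 * ε k < s k) (hε : ∀ k x, |f0 x - g k x| ≤ ε k)
    (hf0 : ∀ x, f0 x ∈ Set.Icc (0:ℝ) 1) (hG : ∀ k, ∀ g' ∈ G k, ∀ x, g' x ∈ Set.Icc (0:ℝ) 1)
    (hep : Monotone ep) (hstart : ∀ t, start (ep t) ≤ t)
    (hnew : ∀ t, ep (t + 1) ≠ ep t → t + 1 ≤ start (ep (t + 1))) (adv : Hist X → X)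
    (T : ℕ) (h : Hist X) :
    expLossNoisy p (epochStrategy η G s M ep start) adv f0 T h ≤
      2 / η ^ 2 * expertPotential η (G (ep h.length)) (g (ep h.length))
          (h.drop (start (ep h.length))) +
        2 / η ^ 2 * (∑ k ∈ Finset.range (ep (h.length + T) + 1), Real.log ((G k).card : ℝ) -
          ∑ k ∈ Finset.range (ep h.length + 1), Real.log ((G k).card : ℝ)) +
        ∑ t ∈ Finset.range T, (3 * ((M (ep (h.length + t)) : ℝ) + 1) * s (ep (h.length + t)) +
          2 / η ^ 2 / ((M (ep (h.length + t)) : ℝ) + 1)) := by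
  have h1' : η < 1 := by linarith
  have hA : 0 < 2 / η ^ 2 := by positivity
  set S : ℕ → ℝ := fun t => ∑ k ∈ Finset.range (ep t + 1), Real.log ((G k).card : ℝ) with hS
  set δ : ℕ → ℝ := fun t => 3 * ((M (ep t) : ℝ) + 1) * s (ep t) +
    2 / η ^ 2 / ((M (ep t) : ℝ) + 1) with hδ
  set V : Hist X → ℝ := fun h => expertPotential η (G (ep h.length)) (g (ep h.length))
    (h.drop (start (ep h.length))) with hV
  change _ ≤ 2 / η ^ 2 * V h + 2 / η ^ 2 * (S (h.length + T) - S h.length) +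
    ∑ t ∈ Finset.range T, δ (h.length + t)
  have hstep : ∀ (h : Hist X) (r : X × ℝ × Bool), V (h ++ [r]) ≤
      expertPotential η (G (ep h.length)) (g (ep h.length))
        (h.drop (start (ep h.length)) ++ [r]) + (S (h.length + 1) - S h.length) := by
    intro h r
    simp only [hV, List.length_append, List.length_singleton]
    by_cases he : ep (h.length + 1) = ep h.length
    · simp only [hS]
      rw [he, List.drop_append_of_le_length (hstart _)]
      linarith
    · have hlt : ep h.length < ep (h.length + 1) :=
        lt_of_le_of_ne (hep (Nat.le_succ _)) (Ne.symm he)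
      rw [List.drop_of_length_le (by simpa using hnew _ he), expertPotential_nil]
      have hnn := expertPotential_nonneg h0 h1' (hg (ep h.length))
        (h.drop (start (ep h.length)) ++ [r])
      have hmono : S h.length ≤
          ∑ k ∈ Finset.range (ep (h.length + 1)), Real.log ((G k).card : ℝ) := by
        refine Finset.sum_le_sum_of_subset_of_nonneg (Finset.range_mono hlt) fun k _ _ => ?_
        exact Real.log_natCast_nonneg _
      have hSe : S (h.length + 1) = ∑ k ∈ Finset.range (ep (h.length + 1)),
          Real.log ((G k).card : ℝ) + Real.log ((G (ep (h.length + 1))).card : ℝ) :=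
        Finset.sum_range_succ _ _
      linarith
  induction T generalizing h with
  | zero =>
    have := mul_nonneg hA.le (expertPotential_nonneg h0 h1' (hg (ep h.length))
      (h.drop (start (ep h.length))))
    simpa [expLossNoisy] using this
  | succ T ih =>
    have hround := expertQuery_round h0 h1 hp0 hp (hg (ep h.length))
      (h.drop (start (ep h.length))) (adv h) (M (ep h.length)) (hs _) (hε _ (adv h))
      (hf0 _) (fun g' hg' => hG _ g' hg' _)
    rw [expLossNoisy]
    simp only [epochStrategy]
    rw [PMF.tsum_map_toReal_mul]
    set n : ℝ := (M (ep h.length) : ℝ) + 1 with hn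
    have hn1 : 0 < n := by positivity
    have hu : ∀ i, ((PMF.uniformOfFintype (Fin (M (ep h.length) + 1) × Bool)) i).toReal =
        1 / (2 * n) := by
      intro i
      rw [PMF.uniformOfFintype_apply, ENNReal.toReal_inv, ENNReal.toReal_natCast]
      simp [hn, mul_comm]
    simp only [hu]
    rw [← Finset.mul_sum]
    set B : ℝ := 2 / η ^ 2 * (S (h.length + (T + 1)) - S h.length) +
      ∑ t ∈ Finset.range T, δ (h.length + 1 + t) with hB
    have hih : ∀ r : X × ℝ × Bool,
        expLossNoisy p (epochStrategy η G s M ep start) adv f0 T (h ++ [r]) ≤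
        2 / η ^ 2 * expertPotential η (G (ep h.length)) (g (ep h.length))
          (h.drop (start (ep h.length)) ++ [r]) + B := by
      intro r
      have a := ih (h ++ [r])
      have b := mul_le_mul_of_nonneg_left (hstep h r) hA.le
      simp only [List.length_append, List.length_singleton] at a
      rw [show h.length + 1 + T = h.length + (T + 1) by ring] at a
      linarith
    set y := expertQuery η (s (ep h.length)) (M (ep h.length)) (G (ep h.length))
      (h.drop (start (ep h.length))) (adv h)
    have hbound : ∀ i, |y i - f0 (adv h)| +
        (1 - p) * expLossNoisy p (epochStrategy η G s M ep start) adv f0 T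
          (h ++ [(adv h, y i, decide (f0 (adv h) < y i))]) +
        p * expLossNoisy p (epochStrategy η G s M ep start) adv f0 T
          (h ++ [(adv h, y i, ! decide (f0 (adv h) < y i))]) ≤
        (|y i - f0 (adv h)| + 2 / η ^ 2 *
          ((1 - p) * expertPotential η (G (ep h.length)) (g (ep h.length))
            (h.drop (start (ep h.length)) ++ [(adv h, y i, decide (f0 (adv h) < y i))]) +
          p * expertPotential η (G (ep h.length)) (g (ep h.length))
            (h.drop (start (ep h.length)) ++ [(adv h, y i, ! decide (f0 (adv h) < y i))]))) +
          B := by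
      intro i
      have a := mul_le_mul_of_nonneg_left (hih (adv h, y i, decide (f0 (adv h) < y i)))
        (by linarith : (0:ℝ) ≤ 1 - p)
      have b := mul_le_mul_of_nonneg_left (hih (adv h, y i, ! decide (f0 (adv h) < y i))) hp0
      linarith
    have hsum := Finset.sum_le_sum fun i (_ : i ∈ Finset.univ) => hbound i
    rw [Finset.sum_add_distrib (g := fun _ => B), Finset.sum_const, nsmul_eq_mul, Finset.card_univ,
      show (Fintype.card (Fin (M (ep h.length) + 1) × Bool) : ℝ) = 2 * n by
        simp [hn, mul_comm]] at hsum
    have htot := mul_le_mul_of_nonneg_left (hsum.trans (add_le_add_left hround _))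
      (by positivity : 0 ≤ 1 / (2 * n))
    refine htot.trans (le_of_eq ?_)
    have hshift : ∑ t ∈ Finset.range T, δ (h.length + (t + 1)) =
        ∑ t ∈ Finset.range T, δ (h.length + 1 + t) :=
      Finset.sum_congr rfl fun t _ => by rw [add_right_comm, add_assoc]
    rw [Finset.sum_range_succ', hshift, hB, add_zero]
    simp only [hV, show δ h.length = 3 * n * s (ep h.length) + 2 / η ^ 2 / n from rfl]
    field_simp
    ring

/-- The first round after the epoch `k`. -/
def epochEnd (r k : ℕ) : ℕ := 2 ^ (r * 2 ^ k)

/-- The epoch of the round `t`. -/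
noncomputable def epochIndex (r t : ℕ) : ℕ := sInf {k | t < epochEnd r k}

/-- The first round of the epoch `k`. -/
def epochStart (r k : ℕ) : ℕ := if k = 0 then 0 else epochEnd r (k - 1)

section Epochs

variable {r : ℕ}

lemma epochEnd_mono : Monotone (epochEnd r) := fun _ _ h =>
  Nat.pow_le_pow_right two_pos (Nat.mul_le_mul_left _ (Nat.pow_le_pow_right two_pos h))

lemma lt_epochEnd_epochIndex (hr : 1 ≤ r) (t : ℕ) : t < epochEnd r (epochIndex r t) := by
  have hne : {k | t < epochEnd r k}.Nonempty := by
    refine ⟨t, ?_⟩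
    calc t < 2 ^ t := Nat.lt_two_pow_self
      _ ≤ 2 ^ (2 ^ t) := Nat.pow_le_pow_right two_pos Nat.lt_two_pow_self.le
      _ ≤ 2 ^ (r * 2 ^ t) := Nat.pow_le_pow_right two_pos (Nat.le_mul_of_pos_left _ hr)
  exact Nat.sInf_mem hne

lemma epochEnd_le_of_lt {t k : ℕ} (h : k < epochIndex r t) : epochEnd r k ≤ t := by
  by_contra hcon
  exact Nat.notMem_of_lt_sInf h (not_le.1 hcon)

lemma epochIndex_mono (hr : 1 ≤ r) : Monotone (epochIndex r) := fun _ b h =>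
  Nat.sInf_le (h.trans_lt (lt_epochEnd_epochIndex hr b))

lemma epochIndex_zero : epochIndex r 0 = 0 :=
  Nat.le_zero.1 (Nat.sInf_le (show 0 < epochEnd r 0 from Nat.two_pow_pos _))

lemma epochStart_epochIndex_le (t : ℕ) : epochStart r (epochIndex r t) ≤ t := by
  unfold epochStart
  split_ifs with h
  · exact Nat.zero_le _
  · exact epochEnd_le_of_lt (by omega)

lemma le_epochStart_of_ne (hr : 1 ≤ r) (t : ℕ) (h : epochIndex r (t + 1) ≠ epochIndex r t) :
    t + 1 ≤ epochStart r (epochIndex r (t + 1)) := by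
  have hle := epochIndex_mono hr (Nat.le_succ t)
  have hlt : epochIndex r t < epochIndex r (t + 1) := lt_of_le_of_ne hle (Ne.symm h)
  unfold epochStart
  rw [if_neg (by omega)]
  exact (lt_epochEnd_epochIndex hr t).trans_le (epochEnd_mono (by omega))

end Epochs

lemma exists_finset_net {X : Type*} {H : Set (X → ℝ)} {ε : ℝ} (h : coveringNumber H ε ≠ ⊤) :
    ∃ G : Finset (X → ℝ), IsENet H (G : Set (X → ℝ)) ε ∧
      G.card = (coveringNumber H ε).toNat := by
  have hne : {n : ℕ∞ | ∃ S : Set (X → ℝ), S.Finite ∧ IsENet H S ε ∧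
      (S.ncard : ℕ∞) = n}.Nonempty := by
    by_contra hcon
    rw [Set.not_nonempty_iff_eq_empty] at hcon
    exact h (by rw [coveringNumber, hcon, sInf_empty])
  obtain ⟨S, hS, hnet, hcard⟩ := csInf_mem hne
  refine ⟨hS.toFinset, by simpa using hnet, ?_⟩
  rw [coveringNumber, ← hcard, ENat.toNat_natCast, Set.ncard_eq_toFinset_card S hS]

lemma sum_range_inv_sq_le (T : ℕ) : ∑ t ∈ Finset.range T, 1 / ((t : ℝ) + 1) ^ 2 ≤ 2 := by
  have h : ∀ T : ℕ, ∑ t ∈ Finset.range (T + 1), 1 / ((t : ℝ) + 1) ^ 2 ≤ 2 - 1 / ((T : ℝ) + 1) := by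
    intro T
    induction T with
    | zero => norm_num
    | succ T ih =>
      rw [Finset.sum_range_succ]
      have : 1 / (((T + 1 : ℕ) : ℝ) + 1) ^ 2 ≤ 1 / ((T : ℝ) + 1) - 1 / (((T + 1 : ℕ) : ℝ) + 1) := by
        push_cast
        rw [div_sub_div _ _ (by positivity) (by positivity),
          div_le_div_iff₀ (by positivity) (by positivity)]
        nlinarith [(Nat.cast_nonneg T : (0:ℝ) ≤ T)]
      linarith
  cases T with
  | zero => simp
  | succ T =>
    have : 0 < 1 / ((T : ℝ) + 1) := by positivity
    linarith [h T]

lemma half_le_log {T : ℕ} (hT : 2 ≤ T) : 1 / 2 ≤ Real.log T := by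
  have : Real.log 2 ≤ Real.log T := Real.log_le_log two_pos (by exact_mod_cast hT)
  linarith [Real.log_two_gt_d9]

lemma epoch_sum_log_le {d : ℝ} (hd : 0 < d) {r : ℕ} (hr : r = max 1 ⌊1 / (16 * d)⌋₊) {N : ℕ → ℕ}
    (hlog : ∀ k, Real.log (N k) ≤ d * (8 * ((r : ℝ) * 2 ^ k) * Real.log 2)) {T : ℕ} (hT : 2 ≤ T) :
    ∑ k ∈ Finset.range (epochIndex r T + 1), Real.log (N k) ≤ 48 * d * Real.log T := by
  have hr1 : 1 ≤ r := hr ▸ le_max_left _ _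
  have hTlog := half_le_log hT
  have hl2 := Real.log_pos one_lt_two
  have hl2' := Real.log_two_lt_d9
  have hfirst : Real.log (N 0) ≤ 8 * d := by
    have h := hlog 0
    rcases hr1.eq_or_lt with h1 | h1
    · rw [← h1] at h
      norm_num at h
      nlinarith
    · have hrf : r = ⌊1 / (16 * d)⌋₊ := by
        rcases max_choice 1 ⌊1 / (16 * d)⌋₊ with h' | h' <;> omega
      have hrle : (r : ℝ) ≤ 1 / (16 * d) := by
        rw [hrf]
        exact Nat.floor_le (by positivity)
      rw [le_div_iff₀ (by positivity)] at hrle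
      have hlt : Real.log (N 0) < Real.log 2 := by
        nlinarith
      have hN : N 0 < 2 := by
        by_contra hcon
        exact absurd (Real.log_le_log two_pos
          (by exact_mod_cast not_lt.1 hcon : (2:ℝ) ≤ N 0)) (not_le.2 hlt)
      have : Real.log (N 0) = 0 := by
        interval_cases N 0 <;> simp
      linarith
  have hgeom : ∀ e : ℕ, ∑ k ∈ Finset.range e, Real.log (N (k + 1)) ≤
      d * (16 * ((r : ℝ) * 2 ^ e) * Real.log 2) := by
    intro e
    have h1 : ∑ k ∈ Finset.range e, (2:ℝ) ^ k ≤ 2 ^ e := by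
      rw [geom_sum_eq (by norm_num)]
      norm_num
    calc ∑ k ∈ Finset.range e, Real.log (N (k + 1))
        ≤ ∑ k ∈ Finset.range e, d * (8 * ((r : ℝ) * 2 ^ (k + 1)) * Real.log 2) :=
          Finset.sum_le_sum fun k _ => hlog (k + 1)
      _ = d * (16 * (r * ∑ k ∈ Finset.range e, (2:ℝ) ^ k) * Real.log 2) := by
          simp only [Finset.mul_sum, Finset.sum_mul]
          refine Finset.sum_congr rfl fun k _ => ?_
          ring
      _ ≤ d * (16 * ((r : ℝ) * 2 ^ e) * Real.log 2) := by gcongr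
  rw [Finset.sum_range_succ']
  rcases Nat.eq_zero_or_pos (epochIndex r T) with he | he
  · rw [he, Finset.range_zero, Finset.sum_empty]
    nlinarith
  · obtain ⟨e, hee⟩ := Nat.exists_eq_succ_of_ne_zero he.ne'
    have hend : epochEnd r e ≤ T := epochEnd_le_of_lt (by omega)
    have hlogT : (r : ℝ) * 2 ^ e * Real.log 2 ≤ Real.log T := by
      have h1 : Real.log (epochEnd r e : ℝ) ≤ Real.log T :=
        Real.log_le_log (by simp [epochEnd]) (by exact_mod_cast hend)
      simpa [epochEnd, Real.log_pow] using h1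
    have := hgeom (e + 1)
    rw [hee]
    rw [pow_succ] at this
    nlinarith

lemma epoch_sum_inv_cube_le {d : ℝ} (hd : 0 < d) {r : ℕ} (hr : r = max 1 ⌊1 / (16 * d)⌋₊) (T : ℕ) :
    ∑ t ∈ Finset.range T, 1 / (epochEnd r (epochIndex r t) : ℝ) ^ 3 ≤ 64 * d := by
  have hr1 : 1 ≤ r := hr ▸ le_max_left _ _
  have hrd : 1 / (2:ℝ) ^ r ≤ 32 * d := by
    have h1 : 1 / (16 * d) < 2 * r := by
      have := Nat.lt_floor_add_one (1 / (16 * d))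
      have h2 : (⌊1 / (16 * d)⌋₊ : ℝ) ≤ r := by
        rw [hr]
        exact_mod_cast le_max_right _ _
      have h3 : (1:ℝ) ≤ r := by exact_mod_cast hr1
      linarith
    have h2 : (r : ℝ) ≤ 2 ^ r := by exact_mod_cast Nat.lt_two_pow_self.le
    rw [div_lt_iff₀ (by positivity)] at h1
    rw [div_le_iff₀ (by positivity)]
    nlinarith
  calc ∑ t ∈ Finset.range T, 1 / (epochEnd r (epochIndex r t) : ℝ) ^ 3
      ≤ ∑ t ∈ Finset.range T, 1 / (2:ℝ) ^ r * (1 / ((t : ℝ) + 1) ^ 2) := by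
        refine Finset.sum_le_sum fun t _ => ?_
        have h1 : (t : ℝ) + 1 ≤ epochEnd r (epochIndex r t) := by
          exact_mod_cast lt_epochEnd_epochIndex hr1 t
        have h2 : (2:ℝ) ^ r ≤ epochEnd r (epochIndex r t) := by
          have : epochEnd r 0 ≤ epochEnd r (epochIndex r t) := epochEnd_mono (Nat.zero_le _)
          simp only [epochEnd, pow_zero, mul_one] at this ⊢
          exact_mod_cast this
        rw [one_div_mul_one_div_rev]
        refine one_div_le_one_div_of_le (by positivity) ?_
        exact (mul_le_mul (pow_le_pow_left₀ (by positivity) h1 2) h2 (by positivity)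
          (by positivity)).trans_eq (by ring)
    _ = 1 / (2:ℝ) ^ r * ∑ t ∈ Finset.range T, 1 / ((t : ℝ) + 1) ^ 2 := by rw [Finset.mul_sum]
    _ ≤ 32 * d * 2 := by
        gcongr
        exact sum_range_inv_sq_le T
    _ = 64 * d := by ring

/-- Always guessing the hidden value incurs no loss. -/
lemma expLossNoisy_pure_eq_zero {X : Type*} (p : ℝ) (f0 g : X → ℝ) (hg : ∀ x, f0 x = g x)
    (adv : Hist X → X) (T : ℕ) (h : Hist X) :
    expLossNoisy p (fun _ x => PMF.pure (g x)) adv f0 T h = 0 := by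
  induction T generalizing h with
  | zero => rfl
  | succ T ih =>
    rw [expLossNoisy]
    simp only [ih, mul_zero, add_zero]
    rw [← tsum_zero (α := ℝ) (β := ℝ)]
    refine tsum_congr fun y => ?_
    by_cases hy : y = g (adv h)
    · simp [hy, hg]
    · simp [PMF.pure_apply, hy]

/-- Online learning with noisy binary feedback (flip probability `p < 1/2`): there is a
randomized strategy with expected total loss at most `C·d·log T`, where `d` is the covering
dimension of the class and `C` depends only on `p`. -/
theorem stmt12 : ∀ p : ℝ, 0 ≤ p → p < 1/2 →
    ∃ C : ℝ, ∀ (X : Type) (H : Set (X → ℝ)),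
    H.Nonempty → (∀ f ∈ H, ∀ x : X, f x ∈ Set.Icc (0:ℝ) 1) →
    ∀ d : ℝ,
    (∀ ε : ℝ, 0 < ε → ε ≤ 1/2 → coveringNumber H ε ≠ ⊤) →
    BddAbove {c : ℝ | ∃ ε : ℝ, 0 < ε ∧ ε ≤ 1/2 ∧
      c = Real.log ((coveringNumber H ε).toNat : ℝ) / Real.log (1/ε)} →
    coveringDim H = d →
    ∃ strat : Hist X → X → PMF ℝ,
      ∀ f0 ∈ H, ∀ T : ℕ, 2 ≤ T → ∀ adv : Hist X → X,
        expLossNoisy p strat adv f0 T [] ≤ C * d * Real.log T := by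
  intro p hp0 hp1
  obtain ⟨η, hη⟩ : ∃ η : ℝ, η = (1 - 2 * p) / 2 := ⟨_, rfl⟩
  have h0 : 0 < η := by linarith
  have h1 : η ≤ 1 / 2 := by linarith
  refine ⟨48 * (2 / η ^ 2) + 128 * (24 + 2 / η ^ 2), ?_⟩
  intro X H hHne hH d hfin hbdd hd
  have hA : 0 < 2 / η ^ 2 := by positivity
  choose! G hnet hcard using fun ε (h : 0 < ε ∧ ε ≤ 1 / 2) => exists_finset_net (hfin ε h.1 h.2)
  have hlogd : ∀ ε : ℝ, 0 < ε → ε ≤ 1 / 2 →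
      Real.log ((G ε).card : ℝ) ≤ d * Real.log (1 / ε) := by
    intro ε hε hε'
    have hpos : 0 < Real.log (1 / ε) :=
      Real.log_pos (by rw [lt_div_iff₀ hε]; linarith)
    rw [hcard ε ⟨hε, hε'⟩, ← div_le_iff₀ hpos, ← hd]
    exact le_csSup hbdd ⟨ε, hε, hε', rfl⟩
  have hd0 : 0 ≤ d := by
    have h2 := hlogd (1 / 2) (by norm_num) le_rfl
    have hpos : 0 < Real.log (1 / (1 / 2)) := Real.log_pos (by norm_num)
    exact nonneg_of_mul_nonneg_left ((Real.log_natCast_nonneg _).trans h2) hpos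
  rcases hd0.eq_or_lt with hzero | hdpos
  · obtain ⟨g, hgH⟩ := hHne
    refine ⟨fun _ x => PMF.pure (g x), fun f0 hf0 T _ adv => ?_⟩
    rw [expLossNoisy_pure_eq_zero p f0 g _ adv, ← hzero]
    · simp
    · intro x
      have hclose : ∀ ε : ℝ, 0 < ε → ε ≤ 1 / 2 → |f0 x - g x| ≤ 2 * ε := by
        intro ε hε hε'
        obtain ⟨a, ha, hfa⟩ := (hnet ε ⟨hε, hε'⟩).2 f0 hf0
        obtain ⟨b, hb, hgb⟩ := (hnet ε ⟨hε, hε'⟩).2 g hgH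
        have hle := hlogd ε hε hε'
        rw [← hzero, zero_mul] at hle
        have hc : (G ε).card ≤ 1 := by
          by_contra hcon
          have : (1:ℝ) < (G ε).card := by exact_mod_cast not_le.1 hcon
          exact absurd (Real.log_pos this) (not_lt.2 hle)
        have hab : a = b := Finset.card_le_one.1 hc a ha b hb
        have h1 := abs_le.1 (hfa x)
        have h2 := abs_le.1 (hgb x)
        rw [hab] at h1
        rw [abs_le]
        constructor <;> linarith
      by_contra hne
      have hpos : 0 < |f0 x - g x| := abs_pos.2 (sub_ne_zero.2 hne)
      have := hclose (min (1 / 2) (|f0 x - g x| / 4)) (by positivity) (min_le_left _ _)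
      linarith [min_le_right (1 / 2) (|f0 x - g x| / 4)]
  · obtain ⟨r, hr⟩ : ∃ r : ℕ, r = max 1 ⌊1 / (16 * d)⌋₊ := ⟨_, rfl⟩
    have hr1 : 1 ≤ r := hr ▸ le_max_left _ _
    have hE2 : ∀ k, (2:ℝ) ≤ epochEnd r k := by
      intro k
      have : 2 ^ 1 ≤ epochEnd r k :=
        Nat.pow_le_pow_right two_pos (Nat.mul_pos hr1 (Nat.two_pow_pos k))
      exact_mod_cast this
    set ε : ℕ → ℝ := fun k => 1 / (epochEnd r k : ℝ) ^ 8 with hε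
    have hεpos : ∀ k, 0 < ε k := fun k => by
      have := hE2 k
      simp only [hε]
      positivity
    have hεhalf : ∀ k, ε k ≤ 1 / 2 := by
      intro k
      refine one_div_le_one_div_of_le two_pos ((hE2 k).trans ?_)
      exact le_self_pow₀ (by linarith [hE2 k]) (by norm_num)
    refine ⟨epochStrategy η (fun k => G (ε k)) (fun k => 4 * ε k) (fun k => epochEnd r k ^ 3)
      (epochIndex r) (epochStart r), fun f0 hf0 T hT adv => ?_⟩
    choose g hgG hg using fun k => (hnet (ε k) ⟨hεpos k, hεhalf k⟩).2 f0 hf0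
    have main := expLossNoisy_epochStrategy_le (ε := ε) (s := fun k => 4 * ε k)
      (M := fun k => epochEnd r k ^ 3) h0 h1 hp0 hη hgG
      (fun k => by linarith [hεpos k]) hg (hH f0 hf0)
      (fun k g' hg' => hH g' ((hnet (ε k) ⟨hεpos k, hεhalf k⟩).1 hg'))
      (epochIndex_mono hr1) epochStart_epochIndex_le (le_epochStart_of_ne hr1) adv T []
    simp only [List.length_nil, epochIndex_zero, List.drop_nil, expertPotential_nil, zero_add,
      Finset.range_one, Finset.sum_singleton] at main
    have hS := epoch_sum_log_le hdpos hr (N := fun k => (G (ε k)).card) (fun k => by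
      refine (hlogd (ε k) (hεpos k) (hεhalf k)).trans (le_of_eq ?_)
      congr 1
      simp [hε, epochEnd, Real.log_pow]
      ring) hT
    have hδ : ∀ t, 3 * (((epochEnd r (epochIndex r t) ^ 3 : ℕ) : ℝ) + 1) *
        (4 * ε (epochIndex r t)) + 2 / η ^ 2 / (((epochEnd r (epochIndex r t) ^ 3 : ℕ) : ℝ) + 1) ≤
        (24 + 2 / η ^ 2) * (1 / (epochEnd r (epochIndex r t) : ℝ) ^ 3) := by
      intro t
      have hE := hE2 (epochIndex r t)
      simp only [hε]
      set E : ℝ := (epochEnd r (epochIndex r t) : ℝ) with hEdef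
      push_cast
      rw [← hEdef]
      have hE1 : 1 ≤ E := by linarith
      have a : 3 * (E ^ 3 + 1) * (4 * (1 / E ^ 8)) ≤ 24 * (1 / E ^ 3) := by
        rw [show 3 * (E ^ 3 + 1) * (4 * (1 / E ^ 8)) = 12 * (E ^ 3 + 1) / E ^ 8 by ring,
          show 24 * (1 / E ^ 3) = 24 * E ^ 5 / E ^ 8 by field_simp]
        have e1 : E ^ 3 ≤ E ^ 5 := pow_le_pow_right₀ hE1 (by norm_num)
        have e2 : 1 ≤ E ^ 5 := one_le_pow₀ hE1
        refine div_le_div_of_nonneg_right ?_ (by positivity)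
        linarith
      have b : 2 / η ^ 2 / (E ^ 3 + 1) ≤ 2 / η ^ 2 * (1 / E ^ 3) := by
        rw [mul_one_div]
        gcongr
        linarith
      linarith
    have hsumδ := (Finset.sum_le_sum fun t (_ : t ∈ Finset.range T) => hδ t).trans
      (le_of_eq (Finset.mul_sum _ _ _).symm)
    have hcube := mul_le_mul_of_nonneg_left (epoch_sum_inv_cube_le hdpos hr T)
      (by positivity : 0 ≤ 24 + 2 / η ^ 2)
    have hSA := mul_le_mul_of_nonneg_left hS hA.le
    have hlogT : (24 + 2 / η ^ 2) * (64 * d) ≤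
        (24 + 2 / η ^ 2) * (64 * d) * (2 * Real.log T) :=
      le_mul_of_one_le_right (by positivity) (by linarith [half_le_log hT])
    linarith
end

section
/- Let T be a finite rooted binary tree in which every internal node has exactly two children, and suppose every node of T is colored with a color from {1, …, c}. Suppose that for each i ∈ {1, …, c}, T does not contain a monochromatic complete binary tree of color i and depth x_i. Then T has a leaf such that, on the path from the root to that leaf, there are at most x_i nodes of color i, for every i ∈ {1, …, c}. -/
/-- A finite rooted binary tree in which every internal node has exactly two
children, and every node carries a color from `Fin c`. -/
inductive CTree (c : ℕ) where
  | leaf : Fin c → CTree c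
  | node : Fin c → CTree c → CTree c → CTree c

/-- `t.mono i k` means `t` contains a monochromatic complete binary tree of color `i`
and depth `k`: there are nodes of `t`, all of color `i`, forming a complete binary tree
of depth `k` under the ancestor–descendant relation of `t`, the two children of each
internal node of the embedded tree lying in the two distinct subtrees of that node in `t`. -/
def CTree.mono {c : ℕ} (i : Fin c) : CTree c → ℕ → Prop
  | .leaf j, k => k = 0 ∧ j = i
  | .node j l r, k =>
      (j = i ∧ (k = 0 ∨ ∃ k', k = k' + 1 ∧ l.mono i k' ∧ r.mono i k'))
        ∨ l.mono i k ∨ r.mono i k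

/-- The list of root-to-leaf paths of a colored tree, each path recorded as the list of
colors of the nodes on it (root first, leaf last). -/
def CTree.paths {c : ℕ} : CTree c → List (List (Fin c))
  | .leaf j => [[j]]
  | .node j l r => (l.paths ++ r.paths).map (List.cons j)

/-- A path good for `x` with the budget of the root color `j` lowered to `k` stays good for `x`
after the root is added. -/
theorem count_cons_le_of_update {c : ℕ} {x : Fin c → ℕ} {j : Fin c} {k : ℕ} (hk : x j = k + 1)
    {p : List (Fin c)} (hp : ∀ i, p.count i ≤ Function.update x j k i) (i : Fin c) :
    (j :: p).count i ≤ x i := by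
  have hpi := hp i
  by_cases hij : i = j
  · subst hij
    simp at hpi
    simp
    omega
  · simpa [List.count_cons, Function.update_of_ne hij, Ne.symm hij] using hpi

/-- Lowering one color's budget preserves the absence of monochromatic trees in a subtree that
avoids the corresponding smaller tree. -/
theorem not_mono_update {c : ℕ} {s : CTree c} {x : Fin c → ℕ} {j : Fin c} {k : ℕ}
    (hs : ∀ i, ¬ s.mono i (x i)) (hj : ¬ s.mono j k) (i : Fin c) :
    ¬ s.mono i (Function.update x j k i) := by
  by_cases hij : i = j
  · subst hij
    simpa using hj
  · simpa [Function.update_of_ne hij] using hs i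

theorem stmt16 {c : ℕ} (t : CTree c) (x : Fin c → ℕ)
    (h : ∀ i : Fin c, ¬ t.mono i (x i)) :
    ∃ p ∈ t.paths, ∀ i : Fin c, p.count i ≤ x i := by
  induction t generalizing x with
  | leaf j =>
    refine ⟨[j], by simp [CTree.paths], fun i => ?_⟩
    have hi := h i
    by_cases hij : j = i
    · simp only [CTree.mono, hij, and_true] at hi
      simp [hij]
      omega
    · simp [hij]
  | node j l r ihl ihr =>
    have hl : ∀ i, ¬ l.mono i (x i) := fun i hi => h i (Or.inr (Or.inl hi))
    have hr : ∀ i, ¬ r.mono i (x i) := fun i hi => h i (Or.inr (Or.inr hi))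
    obtain ⟨k, hk⟩ : ∃ k, x j = k + 1 :=
      Nat.exists_eq_succ_of_ne_zero fun h0 => h j (Or.inl ⟨rfl, Or.inl h0⟩)
    by_cases hlk : l.mono j k
    · have hrk : ¬ r.mono j k := fun hrk => h j (Or.inl ⟨rfl, Or.inr ⟨k, hk, hlk, hrk⟩⟩)
      obtain ⟨p, hp, hpx⟩ := ihr _ (not_mono_update hr hrk)
      exact ⟨j :: p, by simp [CTree.paths, hp], count_cons_le_of_update hk hpx⟩
    · obtain ⟨p, hp, hpx⟩ := ihl _ (not_mono_update hl hlk)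
      exact ⟨j :: p, by simp [CTree.paths, hp], count_cons_le_of_update hk hpx⟩
end

section
/- Let X be a set, (𝒴, ℓ) a metric space, and ℋ a class of functions X → 𝒴. Let S ⊆ ℋ be nonempty with τ(S) < ∞, fix x ∈ X and ε ≥ 0, and define A_ε = { y ∈ 𝒴 : S_y ≠ ∅ and τ(S_y) ≥ τ(S) − ε }, where S_y = { f ∈ S : f(x) = y }. Then every y1, y2 ∈ A_ε satisfy ℓ(y1, y2) ≤ ε. -/
/-- An `(X, 𝒴)`-tree: a finite rooted binary tree in which every internal node has
exactly two children and is labeled by a triple `(x, y₁, y₂)`. -/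
inductive LTree (X Y : Type*) where
  | leaf : LTree X Y
  | node : X → Y → Y → LTree X Y → LTree X Y → LTree X Y

/-- The cost of an `(X, 𝒴)`-tree: the minimum over leaves of the sum of `ℓ(y₁, y₂)`
over the internal nodes on the root-to-leaf path (a single leaf has cost `0`). -/
noncomputable def LTree.cost {X Y : Type*} [MetricSpace Y] : LTree X Y → ℝ
  | .leaf => 0
  | .node _ y1 y2 l r => dist y1 y2 + min l.cost r.cost

/-- `LTree.Sat H t`: the tree `t` is `H`-satisfiable, i.e. each leaf can be labeled
with some `f ∈ H` such that for every internal node `(x, y₁, y₂)`, every leaf label `f`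
in its left subtree satisfies `f x = y₁` and every leaf label in its right subtree
satisfies `f x = y₂`. -/
def LTree.Sat {X Y : Type*} : Set (X → Y) → LTree X Y → Prop
  | H, .leaf => H.Nonempty
  | H, .node x y1 y2 l r => LTree.Sat {f ∈ H | f x = y1} l ∧ LTree.Sat {f ∈ H | f x = y2} r

/-- The tree dimension `τ(H)`: the supremum of the costs of `H`-satisfiable trees. -/
noncomputable def treeDim {X Y : Type*} [MetricSpace Y] (H : Set (X → Y)) : ℝ :=
  sSup (LTree.cost '' {t : LTree X Y | LTree.Sat H t})

/-- A nonempty class satisfies trees of cost arbitrarily close to its tree dimension. -/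
theorem exists_sat_lt_cost {X Y : Type*} [MetricSpace Y] {H : Set (X → Y)} (hH : H.Nonempty)
    {c : ℝ} (hc : c < treeDim H) : ∃ t : LTree X Y, t.Sat H ∧ c < t.cost := by
  have hne : (LTree.cost '' {t : LTree X Y | LTree.Sat H t}).Nonempty :=
    ⟨_, LTree.leaf, hH, rfl⟩
  obtain ⟨_, ⟨t, ht, rfl⟩, hlt⟩ := exists_lt_of_lt_csSup hne hc
  exact ⟨t, ht, hlt⟩

theorem stmt17 {X Y : Type*} [MetricSpace Y] (H : Set (X → Y)) (S : Set (X → Y))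
    (hSH : S ⊆ H) (hSne : S.Nonempty)
    (hfin : BddAbove (LTree.cost '' {t : LTree X Y | LTree.Sat S t}))
    (x : X) (ε : ℝ) (hε : 0 ≤ ε)
    (y1 y2 : Y)
    (h1 : {f ∈ S | f x = y1}.Nonempty ∧ treeDim S - ε ≤ treeDim {f ∈ S | f x = y1})
    (h2 : {f ∈ S | f x = y2}.Nonempty ∧ treeDim S - ε ≤ treeDim {f ∈ S | f x = y2}) :
    dist y1 y2 ≤ ε := by
  refine le_of_forall_pos_le_add fun δ hδ => ?_
  obtain ⟨t1, ht1, hc1⟩ := exists_sat_lt_cost h1.1 (c := treeDim S - ε - δ) (by linarith [h1.2])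
  obtain ⟨t2, ht2, hc2⟩ := exists_sat_lt_cost h2.1 (c := treeDim S - ε - δ) (by linarith [h2.2])
  have hle : dist y1 y2 + min t1.cost t2.cost ≤ treeDim S :=
    le_csSup hfin ⟨.node x y1 y2 t1 t2, ⟨ht1, ht2⟩, rfl⟩
  linarith [lt_min hc1 hc2]
end
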